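/- Under the polynomial scaling, for every fixed r ≥ 0 one has sup_{d ≥ 1} sup_{integers k ≥ κ₁} E[‖Q_k^W‖_op^r] < ∞ and sup_{d ≥ 1} sup_{integers k ≥ κ₂} E[‖Q_k^X‖_op^r] < ∞, where Q_k^W ∈ ℝ^{p×p} has entries (Q_k^W)_{ij} = q_k(√d·⟨w_i, w_j⟩)/√N_k and Q_k^X ∈ ℝ^{n×n} has entries (Q_k^X)_{ij} = q_k(⟨x_i, x_j⟩/√d)/√N_k. -/

import Mathlib

/-!
Uniform moment bounds for Gegenbauer kernel matrices over all degrees `k ≥ κ`. The Gram matrix of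
zonal harmonics at random points is controlled by hypercontractivity of harmonic polynomials and a
chaining argument over dyadic sparsity levels; very large degrees follow from the entrywise size.
-/

open MeasureTheory Filter

noncomputable section

/-- Uniform probability measure on the sphere of radius `r` in `ℝ^d`
(normalized `(d-1)`-dimensional Hausdorff measure). -/
def sphereUniform (d : ℕ) (r : ℝ) : Measure (EuclideanSpace ℝ (Fin d)) :=
  ((Measure.hausdorffMeasure ((d : ℝ) - 1) :
        Measure (EuclideanSpace ℝ (Fin d))) (Metric.sphere 0 r))⁻¹ •
    (Measure.hausdorffMeasure ((d : ℝ) - 1) :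
        Measure (EuclideanSpace ℝ (Fin d))).restrict (Metric.sphere 0 r)

/-- Euclidean inner product. -/
def dotp {d : ℕ} (u v : EuclideanSpace ℝ (Fin d)) : ℝ := ∑ i, u i * v i

/-- `τ_{d,1}`: distribution of `⟨x, e⟩` for `x` uniform on `S^{d-1}(√d)` and `e` a unit vector. -/
def tau1 (d : ℕ) : Measure ℝ :=
  (sphereUniform d (Real.sqrt d)).map fun x => if h : 0 < d then x ⟨0, h⟩ else 0

/-- Dimension `N_{d,k}` of the space of degree-`k` spherical harmonics in dimension `d`. -/
def sphDim (d k : ℕ) : ℕ :=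
  if k = 0 then 1
  else if k = 1 then d
  else ((d + 2 * k - 2) * Nat.choose (d + k - 3) (k - 1)) / k

/-- `q` is the degree-`k` Gegenbauer polynomial for `τ_{d,1}`. -/
def IsGegenbauer (d k : ℕ) (q : Polynomial ℝ) : Prop :=
  q.natDegree = k ∧ 0 < q.leadingCoeff ∧
    (∫ s, q.eval s ^ 2 ∂tau1 d) = 1 ∧
    ∀ j < k, (∫ s, q.eval s * s ^ j ∂tau1 d) = 0

/-- `ℓ² → ℓ²` operator norm of a real matrix. -/
def opNorm {n p : ℕ} (A : Matrix (Fin n) (Fin p) ℝ) : ℝ :=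
  ‖LinearMap.toContinuousLinearMap (Matrix.toEuclideanLin A)‖

/-- Law of `n` i.i.d. uniform points on the sphere of radius `√d`. -/
def Xmeas (d n : ℕ) : Measure (Fin n → EuclideanSpace ℝ (Fin d)) :=
  Measure.pi fun _ => sphereUniform d (Real.sqrt d)

/-- Law of `p` i.i.d. uniform points on the unit sphere. -/
def Wmeas (d p : ℕ) : Measure (Fin p → EuclideanSpace ℝ (Fin d)) :=
  Measure.pi fun _ => sphereUniform d 1

/-- `Q_k^W`: the matrix with entries `q_k(√d ⟨w_i, w_j⟩)/√N_k`. -/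
def QWmat (d p : ℕ) (q : Polynomial ℝ) (Nk : ℕ) (w : Fin p → EuclideanSpace ℝ (Fin d)) :
    Matrix (Fin p) (Fin p) ℝ :=
  Matrix.of fun i j => q.eval (Real.sqrt d * dotp (w i) (w j)) / Real.sqrt Nk

/-- `Q_k^X`: the matrix with entries `q_k(⟨x_i, x_j⟩/√d)/√N_k`. -/
def QXmat (d n : ℕ) (q : Polynomial ℝ) (Nk : ℕ) (x : Fin n → EuclideanSpace ℝ (Fin d)) :
    Matrix (Fin n) (Fin n) ℝ :=
  Matrix.of fun i j => q.eval (dotp (x i) (x j) / Real.sqrt d) / Real.sqrt Nk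

/-- A rotation-invariant probability measure carried by the unit sphere. -/
structure IsSphereLaw {d : ℕ} (σ : Measure (EuclideanSpace ℝ (Fin d))) : Prop where
  prob : IsProbabilityMeasure σ
  norm_eq_one : ∀ᵐ x ∂σ, ‖x‖ = 1
  map_eq : ∀ R : EuclideanSpace ℝ (Fin d) ≃ₗᵢ[ℝ] EuclideanSpace ℝ (Fin d), σ.map R = σ

theorem IsSphereLaw.integrable {d : ℕ} {σ : Measure (EuclideanSpace ℝ (Fin d))}
    (hσ : IsSphereLaw σ) {g : EuclideanSpace ℝ (Fin d) → ℝ} (hg : Continuous g) :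
    Integrable g σ := by
  have := hσ.prob
  obtain ⟨C, hC⟩ := (isCompact_sphere (0 : EuclideanSpace ℝ (Fin d)) 1).exists_bound_of_continuousOn
    hg.continuousOn
  refine Integrable.of_bound hg.aestronglyMeasurable C ?_
  filter_upwards [hσ.norm_eq_one] with x hx
  exact hC x (by simpa using hx)

theorem IsSphereLaw.integral_comp {d : ℕ} {σ : Measure (EuclideanSpace ℝ (Fin d))}
    (hσ : IsSphereLaw σ) {g : EuclideanSpace ℝ (Fin d) → ℝ} (hg : Continuous g)
    (R : EuclideanSpace ℝ (Fin d) ≃ₗᵢ[ℝ] EuclideanSpace ℝ (Fin d)) :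
    ∫ x, g (R x) ∂σ = ∫ x, g x ∂σ := by
  conv_rhs => rw [← hσ.map_eq R]
  rw [integral_map R.continuous.aemeasurable hg.aestronglyMeasurable]

/-- Integral of a polynomial in the coordinates. -/
def polyInt {d : ℕ} (σ : Measure (EuclideanSpace ℝ (Fin d))) (f : MvPolynomial (Fin d) ℝ) : ℝ :=
  ∫ x, MvPolynomial.eval (fun i => x i) f ∂σ

theorem continuous_eval_coord {d : ℕ} (f : MvPolynomial (Fin d) ℝ) :
    Continuous fun x : EuclideanSpace ℝ (Fin d) => MvPolynomial.eval (fun i => x i) f :=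
  (MvPolynomial.continuous_eval f).comp (by fun_prop)

theorem hasDerivAt_eval_curve {d : ℕ} (f : MvPolynomial (Fin d) ℝ) (γ : ℝ → Fin d → ℝ)
    (γ' : Fin d → ℝ) (t : ℝ) (h : ∀ i, HasDerivAt (fun s => γ s i) (γ' i) t) :
    HasDerivAt (fun s => MvPolynomial.eval (γ s) f)
      (∑ i, γ' i * MvPolynomial.eval (γ t) (MvPolynomial.pderiv i f)) t := by
  induction f using MvPolynomial.induction_on with
  | C a => simpa using hasDerivAt_const t a
  | add p q hp hq =>
    simp only [map_add, mul_add, Finset.sum_add_distrib]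
    exact hp.add hq
  | mul_X p j hp =>
    have := hp.mul (h j)
    simp only [map_mul, MvPolynomial.eval_X]
    refine this.congr_deriv ?_
    classical
    simp only [MvPolynomial.pderiv_mul, map_add, map_mul, MvPolynomial.eval_X, mul_add,
      Finset.sum_add_distrib, MvPolynomial.pderiv_X, Finset.sum_mul]
    congr 1
    · exact Finset.sum_congr rfl fun i _ => by ring
    · rw [Finset.sum_eq_single j]
      · simp; ring
      · intro b _ hb
        simp [hb.symm]
      · simp

/-- Rotation by angle `t` in the plane of the coordinates `i` and `j`. -/
def planeRot {d : ℕ} (i j : Fin d) (t : ℝ) (x : EuclideanSpace ℝ (Fin d)) :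
    EuclideanSpace ℝ (Fin d) :=
  WithLp.toLp 2 fun l =>
    if l = i then Real.cos t * x i - Real.sin t * x j
    else if l = j then Real.sin t * x i + Real.cos t * x j else x l

theorem norm_planeRot {d : ℕ} {i j : Fin d} (hij : i ≠ j) (t : ℝ)
    (x : EuclideanSpace ℝ (Fin d)) : ‖planeRot i j t x‖ = ‖x‖ := by
  rw [EuclideanSpace.norm_eq, EuclideanSpace.norm_eq]
  congr 1
  have hs : ∀ g : Fin d → ℝ, ∑ l, g l = g i + g j + ∑ l ∈ (Finset.univ.erase i).erase j, g l := by
    intro g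
    rw [add_assoc, Finset.add_sum_erase _ _ (by simp [hij.symm]), Finset.add_sum_erase _ _ (by simp)]
  rw [hs, hs fun l => ‖x l‖ ^ 2]
  congr 1
  · simp only [planeRot, Real.norm_eq_abs, sq_abs, if_true, if_neg hij.symm]
    linear_combination (x i ^ 2 + x j ^ 2) * Real.sin_sq_add_cos_sq t
  · refine Finset.sum_congr rfl fun l hl => ?_
    simp only [Finset.mem_erase] at hl
    simp [planeRot, hl.1, hl.2.1]

theorem planeRot_neg {d : ℕ} {i j : Fin d} (hij : i ≠ j) (t : ℝ)
    (x : EuclideanSpace ℝ (Fin d)) : planeRot i j (-t) (planeRot i j t x) = x := by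
  ext l
  by_cases hi : l = i
  · subst hi
    simp [planeRot, hij.symm]
    linear_combination (x l) * Real.sin_sq_add_cos_sq t
  · by_cases hj : l = j
    · subst hj
      simp [planeRot, hij.symm]
      linear_combination (x l) * Real.sin_sq_add_cos_sq t
    · simp [planeRot, hi, hj]

/-- `planeRot` as a linear isometry. -/
def planeRotEquiv {d : ℕ} {i j : Fin d} (hij : i ≠ j) (t : ℝ) :
    EuclideanSpace ℝ (Fin d) ≃ₗᵢ[ℝ] EuclideanSpace ℝ (Fin d) where
  toFun := planeRot i j t
  invFun := planeRot i j (-t)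
  left_inv := planeRot_neg hij t
  right_inv x := by simpa using planeRot_neg hij (-t) x
  map_add' x y := by
    ext l
    simp only [planeRot, PiLp.add_apply]
    split_ifs <;> ring
  map_smul' c x := by
    ext l
    simp only [planeRot, PiLp.smul_apply, smul_eq_mul, RingHom.id_apply]
    split_ifs <;> ring
  norm_map' := norm_planeRot hij t

theorem polyInt_add {d : ℕ} {σ : Measure (EuclideanSpace ℝ (Fin d))} (hσ : IsSphereLaw σ)
    (f g : MvPolynomial (Fin d) ℝ) : polyInt σ (f + g) = polyInt σ f + polyInt σ g := by
  simp only [polyInt, map_add]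
  exact integral_add (hσ.integrable (continuous_eval_coord f))
    (hσ.integrable (continuous_eval_coord g))

theorem polyInt_C_mul {d : ℕ} {σ : Measure (EuclideanSpace ℝ (Fin d))} (c : ℝ)
    (f : MvPolynomial (Fin d) ℝ) : polyInt σ (MvPolynomial.C c * f) = c * polyInt σ f := by
  simp only [polyInt, map_mul, MvPolynomial.eval_C]
  exact integral_const_mul _ _

/-- `polyInt` as a linear functional. -/
def polyIntL {d : ℕ} {σ : Measure (EuclideanSpace ℝ (Fin d))} (hσ : IsSphereLaw σ) :
    MvPolynomial (Fin d) ℝ →ₗ[ℝ] ℝ where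
  toFun := polyInt σ
  map_add' := polyInt_add hσ
  map_smul' c f := by rw [MvPolynomial.smul_eq_C_mul, polyInt_C_mul]; rfl

/-- Rotation fields integrate to zero. -/
theorem polyInt_rotation_field {d : ℕ} {σ : Measure (EuclideanSpace ℝ (Fin d))}
    (hσ : IsSphereLaw σ) (i j : Fin d) (f : MvPolynomial (Fin d) ℝ) :
    polyInt σ (MvPolynomial.X i * MvPolynomial.pderiv j f
      - MvPolynomial.X j * MvPolynomial.pderiv i f) = 0 := by
  have := hσ.prob
  by_cases hij : i = j
  · subst hij; simp [polyInt]
  set g := MvPolynomial.X i * MvPolynomial.pderiv j f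
      - MvPolynomial.X j * MvPolynomial.pderiv i f with hg
  have hder : ∀ (x : EuclideanSpace ℝ (Fin d)) (t : ℝ),
      HasDerivAt (fun s => MvPolynomial.eval (fun l => planeRot i j s x l) f)
        (MvPolynomial.eval (fun l => planeRot i j t x l) g) t := by
    intro x t
    have h1 := hasDerivAt_eval_curve f (fun s l => planeRot i j s x l)
      (fun l => if l = i then - planeRot i j t x j else if l = j then planeRot i j t x i else 0) t ?_
    · refine h1.congr_deriv ?_
      have : ∀ l, (if l = i then - planeRot i j t x j else if l = j then planeRot i j t x i else 0)
          * MvPolynomial.eval (fun l => planeRot i j t x l) (MvPolynomial.pderiv l f)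
          = (if l = i then - planeRot i j t x j *
              MvPolynomial.eval (fun l => planeRot i j t x l) (MvPolynomial.pderiv i f) else 0)
          + (if l = j then planeRot i j t x i *
              MvPolynomial.eval (fun l => planeRot i j t x l) (MvPolynomial.pderiv j f) else 0) := by
        intro l
        by_cases h1 : l = i
        · subst h1; simp [hij]
        · by_cases h2 : l = j
          · subst h2; simp [Ne.symm hij]
          · simp [h1, h2]
      rw [Finset.sum_congr rfl fun l _ => this l, Finset.sum_add_distrib]
      simp [hg]; ring
    · intro l
      by_cases h1 : l = i
      · subst h1
        simp only [planeRot, if_true, if_neg (Ne.symm hij)]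
        refine (((Real.hasDerivAt_cos t).mul_const (x l)).sub
          ((Real.hasDerivAt_sin t).mul_const (x j))).congr_deriv ?_
        ring
      · by_cases h2 : l = j
        · subst h2
          simp only [planeRot, if_true, if_neg h1]
          refine (((Real.hasDerivAt_sin t).mul_const (x i)).add
            ((Real.hasDerivAt_cos t).mul_const (x l))).congr_deriv ?_
          ring
        · simp only [planeRot, if_neg h1, if_neg h2]
          exact hasDerivAt_const t (x l)
  obtain ⟨C, hC⟩ := (isCompact_sphere (0 : EuclideanSpace ℝ (Fin d)) 1).exists_bound_of_continuousOn
    (continuous_eval_coord g).continuousOn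
  have hcr : ∀ t, Continuous (planeRot i j t) := fun t => (planeRotEquiv hij t).continuous
  have key := hasDerivAt_integral_of_dominated_loc_of_deriv_le (μ := σ) (x₀ := (0 : ℝ))
    (s := Set.univ) (bound := fun _ => C)
    (F := fun s x => MvPolynomial.eval (fun l => planeRot i j s x l) f)
    (F' := fun s x => MvPolynomial.eval (fun l => planeRot i j s x l) g) univ_mem
    (Eventually.of_forall fun t =>
      ((continuous_eval_coord f).comp (hcr t)).aestronglyMeasurable)
    (hσ.integrable ((continuous_eval_coord f).comp (hcr 0)))
    ((continuous_eval_coord g).comp (hcr 0)).aestronglyMeasurable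
    (by
      filter_upwards [hσ.norm_eq_one] with x hx t _
      exact hC (planeRot i j t x) (by simpa [norm_planeRot hij] using hx))
    (integrable_const C) (Eventually.of_forall fun x t _ => hder x t)
  have hconst : (fun s => ∫ x, MvPolynomial.eval (fun l => planeRot i j s x l) f ∂σ)
      = fun _ => polyInt σ f := by
    funext s
    exact hσ.integral_comp (continuous_eval_coord f) (planeRotEquiv hij s)
  rw [hconst] at key
  have h0 := key.2.unique (hasDerivAt_const (0 : ℝ) (polyInt σ f))
  have hid : ∀ x : EuclideanSpace ℝ (Fin d), planeRot i j 0 x = x := by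
    intro x; ext l
    simp only [planeRot]
    split_ifs with h1 h2 <;> simp [*]
  simp only [hid] at h0
  exact h0

theorem polyInt_sum_sq_mul {d : ℕ} {σ : Measure (EuclideanSpace ℝ (Fin d))}
    (hσ : IsSphereLaw σ) (f : MvPolynomial (Fin d) ℝ) :
    polyInt σ ((∑ j, MvPolynomial.X j ^ 2) * f) = polyInt σ f := by
  refine integral_congr_ae ?_
  filter_upwards [hσ.norm_eq_one] with x hx
  have : ∑ i, x i ^ 2 = 1 := by
    rw [← EuclideanSpace.real_norm_sq_eq, hx]; norm_num
  simp [this]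

/-- Integration by parts on the unit sphere. -/
theorem polyInt_X_mul {d : ℕ} {σ : Measure (EuclideanSpace ℝ (Fin d))}
    (hσ : IsSphereLaw σ) {f : MvPolynomial (Fin d) ℝ} {m : ℕ} (hf : f.IsHomogeneous m)
    (i : Fin d) :
    ((d : ℝ) + m - 1) * polyInt σ (MvPolynomial.X i * f) = polyInt σ (MvPolynomial.pderiv i f) := by
  have h0 : ∑ j, polyIntL hσ (MvPolynomial.X i * MvPolynomial.pderiv j (MvPolynomial.X j * f)
      - MvPolynomial.X j * MvPolynomial.pderiv i (MvPolynomial.X j * f)) = 0 :=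
    Finset.sum_eq_zero fun j _ => polyInt_rotation_field hσ i j _
  rw [← map_sum] at h0
  have h1 : ∑ j, (MvPolynomial.X i * MvPolynomial.pderiv j (MvPolynomial.X j * f)
      - MvPolynomial.X j * MvPolynomial.pderiv i (MvPolynomial.X j * f))
      = MvPolynomial.C ((d : ℝ) + m - 1) * (MvPolynomial.X i * f)
        - (∑ j, MvPolynomial.X j ^ 2) * MvPolynomial.pderiv i f := by
    have he := hf.sum_X_mul_pderiv
    have h2 : ∑ j, MvPolynomial.X j * MvPolynomial.pderiv i (MvPolynomial.X j * f)
        = MvPolynomial.X i * f + (∑ j, MvPolynomial.X j ^ 2) * MvPolynomial.pderiv i f := by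
      classical
      simp only [MvPolynomial.pderiv_mul, MvPolynomial.pderiv_X, mul_add, Finset.sum_add_distrib,
        Finset.sum_mul]
      congr 1
      · rw [Finset.sum_eq_single i]
        · simp
        · intro b _ hb; simp [hb]
        · simp
      · exact Finset.sum_congr rfl fun j _ => by ring
    have h3 : ∑ j, MvPolynomial.X i * MvPolynomial.pderiv j (MvPolynomial.X j * f)
        = MvPolynomial.X i * ((d : MvPolynomial (Fin d) ℝ) * f + (m : MvPolynomial (Fin d) ℝ) * f) := by
      rw [← Finset.mul_sum]
      simp only [MvPolynomial.pderiv_mul, MvPolynomial.pderiv_X_self, Finset.sum_add_distrib, he]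
      simp
    rw [Finset.sum_sub_distrib, h2, h3]
    simp only [map_sub, map_add, map_natCast, map_one]
    ring
  rw [h1, map_sub, sub_eq_zero] at h0
  have h4 := polyInt_sum_sq_mul hσ (MvPolynomial.pderiv i f)
  rw [← h4, ← polyInt_C_mul]
  exact h0

open MvPolynomial in
/-- Homogeneous harmonic polynomials of degree `k`. -/
structure IsHarm {d : ℕ} (k : ℕ) (f : MvPolynomial (Fin d) ℝ) : Prop where
  homogeneous : f.IsHomogeneous k
  laplacian : ∑ i, pderiv i (pderiv i f) = 0

theorem pderiv_comm {d : ℕ} (i j : Fin d) (f : MvPolynomial (Fin d) ℝ) :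
    MvPolynomial.pderiv i (MvPolynomial.pderiv j f)
      = MvPolynomial.pderiv j (MvPolynomial.pderiv i f) := by
  have h : ⁅(MvPolynomial.pderiv i :
      Derivation ℝ (MvPolynomial (Fin d) ℝ) (MvPolynomial (Fin d) ℝ)), (MvPolynomial.pderiv j :
      Derivation ℝ (MvPolynomial (Fin d) ℝ) (MvPolynomial (Fin d) ℝ))⁆ = 0 := by
    refine MvPolynomial.derivation_ext fun l => ?_
    classical
    simp [Derivation.commutator_apply, MvPolynomial.pderiv_X, Pi.single_apply, apply_ite]
  have h2 := congrArg (fun D => D f) h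
  simpa [Derivation.commutator_apply, sub_eq_zero] using h2

theorem IsHarm.pderiv {d k : ℕ} {f : MvPolynomial (Fin d) ℝ} (hf : IsHarm (k + 1) f)
    (i : Fin d) : IsHarm k (MvPolynomial.pderiv i f) where
  homogeneous := hf.homogeneous.pderiv
  laplacian := by
    have h := congrArg (MvPolynomial.pderiv i) hf.laplacian
    rw [map_sum, map_zero] at h
    rw [← h]
    exact Finset.sum_congr rfl fun j _ => by
      rw [pderiv_comm j i f, pderiv_comm j i (MvPolynomial.pderiv j f)]

theorem IsHarm.add {d k : ℕ} {f g : MvPolynomial (Fin d) ℝ} (hf : IsHarm k f)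
    (hg : IsHarm k g) : IsHarm k (f + g) where
  homogeneous := hf.homogeneous.add hg.homogeneous
  laplacian := by
    simp only [map_add, Finset.sum_add_distrib, hf.laplacian, hg.laplacian, add_zero]

theorem IsHarm.zero {d k : ℕ} : IsHarm k (0 : MvPolynomial (Fin d) ℝ) where
  homogeneous := MvPolynomial.isHomogeneous_zero _ _ _
  laplacian := by simp

theorem IsHarm.C_mul {d k : ℕ} {f : MvPolynomial (Fin d) ℝ} (hf : IsHarm k f) (c : ℝ) :
    IsHarm k (MvPolynomial.C c * f) where
  homogeneous := hf.homogeneous.C_mul c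
  laplacian := by
    simp only [MvPolynomial.pderiv_C_mul, ← Finset.mul_sum, hf.laplacian, mul_zero]

theorem IsHarm.sum {d k : ℕ} {ι : Type*} (s : Finset ι) (f : ι → MvPolynomial (Fin d) ℝ)
    (hf : ∀ i ∈ s, IsHarm k (f i)) : IsHarm k (∑ i ∈ s, f i) := by
  classical
  induction s using Finset.induction_on with
  | empty => simpa using IsHarm.zero
  | insert a s ha ih =>
    rw [Finset.sum_insert ha]
    exact (hf a (by simp)).add (ih fun i hi => hf i (by simp [hi]))

/-- Green's identity for a harmonic polynomial on the unit sphere. -/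
theorem IsHarm.green {d k l : ℕ} {σ : Measure (EuclideanSpace ℝ (Fin d))} (hσ : IsSphereLaw σ)
    {f g : MvPolynomial (Fin d) ℝ} (hf : IsHarm (k + 1) f) (hg : g.IsHomogeneous l) :
    ((k : ℝ) + 1) * ((d : ℝ) + k + l - 1) * polyInt σ (f * g)
      = ∑ i, polyInt σ (MvPolynomial.pderiv i f * MvPolynomial.pderiv i g) := by
  have h1 : MvPolynomial.C ((k : ℝ) + 1) * (f * g)
      = ∑ i, MvPolynomial.X i * (MvPolynomial.pderiv i f * g) := by
    have he := hf.homogeneous.sum_X_mul_pderiv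
    simp only [← mul_assoc, ← Finset.sum_mul, he]
    simp
  have h2 : ((k : ℝ) + 1) * polyInt σ (f * g)
      = ∑ i, polyInt σ (MvPolynomial.X i * (MvPolynomial.pderiv i f * g)) := by
    rw [← polyInt_C_mul, h1]
    exact map_sum (polyIntL hσ) _ _
  have h3 : ∀ i, ((d : ℝ) + k + l - 1) * polyInt σ (MvPolynomial.X i * (MvPolynomial.pderiv i f * g))
      = polyInt σ (MvPolynomial.pderiv i (MvPolynomial.pderiv i f) * g)
        + polyInt σ (MvPolynomial.pderiv i f * MvPolynomial.pderiv i g) := by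
    intro i
    have := polyInt_X_mul hσ ((hf.pderiv i).homogeneous.mul hg) i
    rw [MvPolynomial.pderiv_mul, polyInt_add hσ] at this
    rw [← this]
    push_cast; ring
  calc _ = ((d : ℝ) + k + l - 1) * (((k : ℝ) + 1) * polyInt σ (f * g)) := by ring
    _ = ∑ i, polyInt σ (MvPolynomial.pderiv i (MvPolynomial.pderiv i f) * g)
        + ∑ i, polyInt σ (MvPolynomial.pderiv i f * MvPolynomial.pderiv i g) := by
      rw [h2, Finset.mul_sum, Finset.sum_congr rfl fun i _ => h3 i, Finset.sum_add_distrib]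
    _ = _ := by
      have : ∑ i, polyInt σ (MvPolynomial.pderiv i (MvPolynomial.pderiv i f) * g)
          = polyIntL hσ (∑ i, MvPolynomial.pderiv i (MvPolynomial.pderiv i f) * g) :=
        (map_sum (polyIntL hσ) _ _).symm
      rw [this, ← Finset.sum_mul, hf.laplacian, zero_mul, map_zero, zero_add]

/-- Harmonic polynomials of different degrees are orthogonal. -/
theorem IsHarm.orthogonal {d k l : ℕ} (hd : 2 ≤ d) {σ : Measure (EuclideanSpace ℝ (Fin d))}
    (hσ : IsSphereLaw σ) {f g : MvPolynomial (Fin d) ℝ} (hf : IsHarm k f) (hg : IsHarm l g)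
    (hkl : l < k) : polyInt σ (f * g) = 0 := by
  obtain ⟨k, rfl⟩ : ∃ m, k = m + 1 := ⟨k - 1, by omega⟩
  have hd' : (2 : ℝ) ≤ d := by exact_mod_cast hd
  have hk0 : (0 : ℝ) ≤ k := by positivity
  have h1 := hf.green hσ hg.homogeneous
  obtain _ | l := l
  · have h0 : ∀ i, MvPolynomial.pderiv i g = 0 := by
      intro i
      have := hg.homogeneous
      rw [← MvPolynomial.totalDegree_zero_iff_isHomogeneous,
        MvPolynomial.totalDegree_eq_zero_iff_eq_C] at this
      rw [this, MvPolynomial.pderiv_C]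
    have hz : polyInt σ 0 = 0 := by simp [polyInt]
    simp only [h0, mul_zero, hz, Finset.sum_const_zero] at h1
    refine (mul_eq_zero.1 h1).resolve_left (ne_of_gt ?_)
    push_cast
    apply mul_pos <;> linarith
  · have h2 := hg.green hσ hf.homogeneous
    have hl0 : (0 : ℝ) ≤ l := by positivity
    have hkl' : (l : ℝ) + 1 ≤ k := by exact_mod_cast (by omega : l + 1 ≤ k)
    rw [mul_comm g f, Finset.sum_congr rfl fun i _ => by
      rw [mul_comm (MvPolynomial.pderiv i g)], ← h1] at h2
    have h3 : (((k : ℝ) - l) * (d + k + l)) * polyInt σ (f * g) = 0 := by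
      push_cast at h2
      linear_combination -h2
    refine (mul_eq_zero.1 h3).resolve_left (ne_of_gt ?_)
    apply mul_pos <;> linarith

theorem polyInt_holder {d : ℕ} {σ : Measure (EuclideanSpace ℝ (Fin d))} (hσ : IsSphereLaw σ)
    (f g : MvPolynomial (Fin d) ℝ) (q : ℕ) :
    polyInt σ (f ^ (2 * (q + 1)) * g ^ 2)
      ≤ polyInt σ (f ^ (2 * (q + 2))) ^ (((q : ℝ) + 1) / (q + 2))
        * polyInt σ (g ^ (2 * (q + 2))) ^ (1 / ((q : ℝ) + 2)) := by
  have hpq : (((q : ℝ) + 2) / (q + 1)).HolderConjugate ((q : ℝ) + 2) := by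
    rw [Real.holderConjugate_iff]
    constructor
    · rw [lt_div_iff₀ (by positivity)]; linarith
    · field_simp; ring
  have hm : ∀ (u : MvPolynomial (Fin d) ℝ) (p : ENNReal), MemLp
      (fun x : EuclideanSpace ℝ (Fin d) => MvPolynomial.eval (fun i => x i) u) p σ := by
    intro u p
    have := hσ.prob
    obtain ⟨C, hC⟩ := (isCompact_sphere (0 : EuclideanSpace ℝ (Fin d)) 1).exists_bound_of_continuousOn
      (continuous_eval_coord u).continuousOn
    refine MemLp.of_bound (continuous_eval_coord u).aestronglyMeasurable C ?_
    filter_upwards [hσ.norm_eq_one] with x hx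
    exact hC x (by simpa using hx)
  have h := integral_mul_le_Lp_mul_Lq_of_nonneg (μ := σ) hpq
    (f := fun x => MvPolynomial.eval (fun i => x i) (f ^ (2 * (q + 1))))
    (g := fun x => MvPolynomial.eval (fun i => x i) (g ^ 2))
    (Eventually.of_forall fun x => by
      simp only [map_pow, Pi.zero_apply]; exact (even_two_mul _).pow_nonneg _)
    (Eventually.of_forall fun x => by simp only [map_pow, Pi.zero_apply]; positivity)
    (hm _ _) (hm _ _)
  have e1 : ∀ x : ℝ, (x ^ (2 * (q + 1))) ^ (((q : ℝ) + 2) / (q + 1)) = x ^ (2 * (q + 2)) := by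
    intro x
    rw [pow_mul, pow_mul, ← Real.rpow_natCast (x ^ 2) (q + 1), ← Real.rpow_mul (sq_nonneg x),
      ← Real.rpow_natCast (x ^ 2) (q + 2)]
    congr 1; push_cast; field_simp
  have e2 : ∀ x : ℝ, (x ^ 2) ^ ((q : ℝ) + 2) = x ^ (2 * (q + 2)) := by
    intro x
    rw [pow_mul, ← Real.rpow_natCast (x ^ 2) (q + 2)]
    congr 1; push_cast; ring
  simp only [map_pow, e1, e2, one_div_div] at h
  simpa only [polyInt, map_mul, map_pow] using h

theorem polyInt_nonneg {d : ℕ} {σ : Measure (EuclideanSpace ℝ (Fin d))}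
    {f : MvPolynomial (Fin d) ℝ} (hf : ∀ x, 0 ≤ MvPolynomial.eval x f) : 0 ≤ polyInt σ f :=
  integral_nonneg fun _ => hf _

/-- Hypercontractivity for harmonic polynomials on the unit sphere. -/
theorem IsHarm.hypercontractive {d : ℕ} (hd : 0 < d) {σ : Measure (EuclideanSpace ℝ (Fin d))}
    (hσ : IsSphereLaw σ) (q : ℕ) : ∀ (k : ℕ) {f : MvPolynomial (Fin d) ℝ}, IsHarm k f →
    polyInt σ (f ^ (2 * (q + 2))) ≤ ((2 * (q : ℝ) + 3) ^ k * polyInt σ (f ^ 2)) ^ (q + 2) := by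
  have := hσ.prob
  have hd' : (1 : ℝ) ≤ d := by exact_mod_cast hd
  intro k
  induction k with
  | zero =>
    intro f hf
    have := hf.homogeneous
    rw [← MvPolynomial.totalDegree_zero_iff_isHomogeneous,
      MvPolynomial.totalDegree_eq_zero_iff_eq_C] at this
    rw [this]
    simp [polyInt, pow_mul]
  | succ k ih =>
    intro f hf
    set A := polyInt σ (f ^ (2 * (q + 2))) with hA
    set B := polyInt σ (f ^ 2) with hB
    set c : ℝ := 2 * (q : ℝ) + 3 with hc
    have hc0 : 0 < c := by positivity
    have hA0 : 0 ≤ A := polyInt_nonneg fun x => by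
      rw [map_pow]; exact (even_two_mul _).pow_nonneg _
    have hB0 : 0 ≤ B := polyInt_nonneg fun x => by rw [map_pow]; positivity
    have hgB := hf.green hσ hf.homogeneous
    have hgA := hf.green hσ (hf.homogeneous.pow (2 * q + 3))
    have e1 : f * f ^ (2 * q + 3) = f ^ (2 * (q + 2)) := by ring
    have e2 : ∀ i, MvPolynomial.pderiv i f * MvPolynomial.pderiv i (f ^ (2 * q + 3))
        = MvPolynomial.C c * (f ^ (2 * (q + 1)) * MvPolynomial.pderiv i f ^ 2) := by
      intro i
      rw [MvPolynomial.pderiv_pow, hc]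
      simp only [map_add, map_mul, map_natCast, map_ofNat]
      push_cast
      ring
    simp only [e2, e1, polyInt_C_mul, ← Finset.mul_sum] at hgA
    simp only [← sq] at hgB
    rw [← hA] at hgA
    rw [← hB] at hgB
    have hstep : ∀ i, polyInt σ (f ^ (2 * (q + 1)) * MvPolynomial.pderiv i f ^ 2)
        ≤ A ^ (((q : ℝ) + 1) / (q + 2)) * (c ^ k * polyInt σ (MvPolynomial.pderiv i f ^ 2)) := by
      intro i
      refine (polyInt_holder hσ f (MvPolynomial.pderiv i f) q).trans ?_
      refine mul_le_mul_of_nonneg_left ?_ (Real.rpow_nonneg hA0 _)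
      have h1 : 0 ≤ c ^ k * polyInt σ (MvPolynomial.pderiv i f ^ 2) :=
        mul_nonneg (by positivity) (polyInt_nonneg fun x => by rw [map_pow]; positivity)
      calc _ ≤ ((c ^ k * polyInt σ (MvPolynomial.pderiv i f ^ 2)) ^ (q + 2)) ^ (1 / ((q : ℝ) + 2)) := by
            refine Real.rpow_le_rpow (polyInt_nonneg fun x => ?_) (ih (hf.pderiv i)) (by positivity)
            rw [map_pow]; exact (even_two_mul _).pow_nonneg _
        _ = _ := by
            rw [← Real.rpow_natCast, ← Real.rpow_mul h1]
            push_cast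
            rw [mul_one_div_cancel (by positivity), Real.rpow_one]
    have hsum := Finset.sum_le_sum fun i (_ : i ∈ Finset.univ) => hstep i
    rw [← Finset.mul_sum, ← Finset.mul_sum, ← hgB] at hsum
    have hAle : A ≤ A ^ (((q : ℝ) + 1) / (q + 2)) * (c ^ (k + 1) * B) := by
      have hpos : 0 < ((k : ℝ) + 1) * ((d : ℝ) + k + ((k + 1 : ℕ) : ℝ) - 1) := by
        push_cast
        have : (0 : ℝ) ≤ k := by positivity
        apply mul_pos <;> linarith
      have hle : ((k : ℝ) + 1) * ((d : ℝ) + k + ((k + 1 : ℕ) : ℝ) - 1) * A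
          ≤ ((k : ℝ) + 1) * ((d : ℝ) + k + (((k + 1) * (2 * q + 3) : ℕ) : ℝ) - 1) * A := by
        refine mul_le_mul_of_nonneg_right ?_ hA0
        refine mul_le_mul_of_nonneg_left ?_ (by positivity)
        have : ((k + 1 : ℕ) : ℝ) ≤ (((k + 1) * (2 * q + 3) : ℕ) : ℝ) := by
          exact_mod_cast Nat.le_mul_of_pos_right _ (by omega)
        linarith
      rw [hgA] at hle
      have h2 := hle.trans (mul_le_mul_of_nonneg_left hsum hc0.le)
      refine le_of_mul_le_mul_left (h2.trans (le_of_eq ?_)) hpos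
      ring
    have hcB : 0 ≤ c ^ (k + 1) * B := by positivity
    rcases hA0.eq_or_lt with h0 | h0
    · rw [← h0]; positivity
    · have h3 : A ^ (1 / ((q : ℝ) + 2)) ≤ c ^ (k + 1) * B := by
        have h4 : A = A ^ (((q : ℝ) + 1) / (q + 2)) * A ^ (1 / ((q : ℝ) + 2)) := by
          rw [← Real.rpow_add h0]
          have : ((q : ℝ) + 1) / (q + 2) + 1 / ((q : ℝ) + 2) = 1 := by field_simp; ring
          rw [this, Real.rpow_one]
        rw [h4] at hAle
        refine le_of_mul_le_mul_left (hAle.trans_eq ?_) (Real.rpow_pos_of_pos h0 _)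
        rw [← h4]
      calc A = (A ^ (1 / ((q : ℝ) + 2))) ^ (q + 2) := by
            rw [← Real.rpow_natCast, ← Real.rpow_mul hA0]
            push_cast
            rw [one_div_mul_cancel (by positivity), Real.rpow_one]
        _ ≤ _ := pow_le_pow_left₀ (by positivity) h3 _

/-- The linear form `x ↦ ⟨y, x⟩`. -/
def linForm {d : ℕ} (y : Fin d → ℝ) : MvPolynomial (Fin d) ℝ :=
  ∑ i, MvPolynomial.C (y i) * MvPolynomial.X i

/-- The quadratic form `x ↦ ‖x‖²`. -/
def sqForm (d : ℕ) : MvPolynomial (Fin d) ℝ := ∑ i, MvPolynomial.X i ^ 2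

/-- Derivative in the direction `y`. -/
def dirDeriv {d : ℕ} (y : Fin d → ℝ) (f : MvPolynomial (Fin d) ℝ) : MvPolynomial (Fin d) ℝ :=
  ∑ i, MvPolynomial.C (y i) * MvPolynomial.pderiv i f

/-- The Laplacian. -/
def laplacian {d : ℕ} (f : MvPolynomial (Fin d) ℝ) : MvPolynomial (Fin d) ℝ :=
  ∑ i, MvPolynomial.pderiv i (MvPolynomial.pderiv i f)

/-- The zonal harmonic of degree `k` with pole `y`, normalized to be `1` at `y`. -/
def zonal {d : ℕ} (y : Fin d → ℝ) : ℕ → MvPolynomial (Fin d) ℝ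
  | 0 => 1
  | 1 => linForm y
  | k + 2 => MvPolynomial.C (1 / ((k : ℝ) + d - 1)) *
      (MvPolynomial.C (2 * (k : ℝ) + d) * (linForm y * zonal y (k + 1))
        - MvPolynomial.C ((k : ℝ) + 1) * (sqForm d * zonal y k))

/-- The Legendre polynomial in dimension `d`, normalized to be `1` at `1`. -/
def legendre (d : ℕ) : ℕ → Polynomial ℝ
  | 0 => 1
  | 1 => Polynomial.X
  | k + 2 => Polynomial.C (1 / ((k : ℝ) + d - 1)) *
      (Polynomial.C (2 * (k : ℝ) + d) * (Polynomial.X * legendre d (k + 1))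
        - Polynomial.C ((k : ℝ) + 1) * legendre d k)

theorem pderiv_linForm {d : ℕ} (y : Fin d → ℝ) (i : Fin d) :
    MvPolynomial.pderiv i (linForm y) = MvPolynomial.C (y i) := by
  classical
  simp [linForm, map_sum, MvPolynomial.pderiv_X, Pi.single_apply]

theorem pderiv_sqForm {d : ℕ} (i : Fin d) :
    MvPolynomial.pderiv i (sqForm d) = 2 * MvPolynomial.X i := by
  classical
  simp [sqForm, map_sum, MvPolynomial.pderiv_X, Pi.single_apply]

theorem dirDeriv_sub {d : ℕ} (y : Fin d → ℝ) (f g : MvPolynomial (Fin d) ℝ) :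
    dirDeriv y (f - g) = dirDeriv y f - dirDeriv y g := by
  simp [dirDeriv, mul_sub, Finset.sum_sub_distrib]

theorem dirDeriv_mul {d : ℕ} (y : Fin d → ℝ) (f g : MvPolynomial (Fin d) ℝ) :
    dirDeriv y (f * g) = dirDeriv y f * g + f * dirDeriv y g := by
  simp only [dirDeriv, MvPolynomial.pderiv_mul, Finset.sum_mul, Finset.mul_sum,
    ← Finset.sum_add_distrib]
  exact Finset.sum_congr rfl fun i _ => by ring

theorem dirDeriv_C {d : ℕ} (y : Fin d → ℝ) (c : ℝ) :
    dirDeriv y (MvPolynomial.C c) = 0 := by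
  simp [dirDeriv]

theorem dirDeriv_linForm {d : ℕ} {y : Fin d → ℝ} (hy : ∑ i, y i ^ 2 = 1) :
    dirDeriv y (linForm y) = 1 := by
  simp only [dirDeriv, pderiv_linForm, ← sq, ← map_pow, ← map_sum, hy, map_one]

theorem dirDeriv_sqForm {d : ℕ} (y : Fin d → ℝ) :
    dirDeriv y (sqForm d) = 2 * linForm y := by
  simp only [dirDeriv, pderiv_sqForm, linForm, Finset.mul_sum]
  exact Finset.sum_congr rfl fun i _ => by ring

theorem laplacian_sub {d : ℕ} (f g : MvPolynomial (Fin d) ℝ) :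
    laplacian (f - g) = laplacian f - laplacian g := by
  simp [laplacian, Finset.sum_sub_distrib]

theorem laplacian_C_mul {d : ℕ} (c : ℝ) (f : MvPolynomial (Fin d) ℝ) :
    laplacian (MvPolynomial.C c * f) = MvPolynomial.C c * laplacian f := by
  simp only [laplacian, MvPolynomial.pderiv_C_mul, Finset.mul_sum]

theorem laplacian_linForm_mul {d : ℕ} (y : Fin d → ℝ) (f : MvPolynomial (Fin d) ℝ) :
    laplacian (linForm y * f) = linForm y * laplacian f + 2 * dirDeriv y f := by
  simp only [laplacian, dirDeriv, MvPolynomial.pderiv_mul, map_add, pderiv_linForm,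
    MvPolynomial.pderiv_C, Finset.mul_sum, ← Finset.sum_add_distrib]
  exact Finset.sum_congr rfl fun i _ => by ring

theorem laplacian_sqForm_mul {d m : ℕ} {f : MvPolynomial (Fin d) ℝ} (hf : f.IsHomogeneous m) :
    laplacian (sqForm d * f)
      = sqForm d * laplacian f + MvPolynomial.C (2 * (d : ℝ) + 4 * m) * f := by
  have he := hf.sum_X_mul_pderiv
  have h : ∀ i, MvPolynomial.pderiv i (MvPolynomial.pderiv i (sqForm d * f))
      = sqForm d * MvPolynomial.pderiv i (MvPolynomial.pderiv i f)
        + 4 * (MvPolynomial.X i * MvPolynomial.pderiv i f) + 2 * f := by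
    intro i
    have h2 : MvPolynomial.pderiv i (2 : MvPolynomial (Fin d) ℝ) = 0 := by
      have : (2 : MvPolynomial (Fin d) ℝ) = MvPolynomial.C 2 :=
        (map_ofNat MvPolynomial.C 2).symm
      rw [this, MvPolynomial.pderiv_C]
    simp only [MvPolynomial.pderiv_mul, map_add, pderiv_sqForm, MvPolynomial.pderiv_X_self, h2]
    ring
  simp only [laplacian, h, Finset.sum_add_distrib, ← Finset.mul_sum, he]
  simp only [map_add, map_mul, map_natCast, map_ofNat, Finset.sum_const, Finset.card_univ,
    Fintype.card_fin, nsmul_eq_mul]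
  ring

theorem linForm_isHomogeneous {d : ℕ} (y : Fin d → ℝ) : (linForm y).IsHomogeneous 1 :=
  MvPolynomial.IsHomogeneous.sum _ _ _ fun i _ =>
    (MvPolynomial.isHomogeneous_X ℝ i).C_mul _

theorem sqForm_isHomogeneous (d : ℕ) : (sqForm d).IsHomogeneous 2 :=
  MvPolynomial.IsHomogeneous.sum _ _ _ fun i _ => (MvPolynomial.isHomogeneous_X ℝ i).pow 2

theorem zonal_isHomogeneous {d : ℕ} (y : Fin d → ℝ) :
    ∀ k, (zonal y k).IsHomogeneous k
  | 0 => MvPolynomial.isHomogeneous_one _ _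
  | 1 => linForm_isHomogeneous y
  | k + 2 => by
    rw [zonal]
    refine MvPolynomial.IsHomogeneous.C_mul (MvPolynomial.IsHomogeneous.sub ?_ ?_) _
    · have := ((linForm_isHomogeneous y).mul (zonal_isHomogeneous y (k + 1))).C_mul
        (2 * (k : ℝ) + d)
      rwa [show 1 + (k + 1) = k + 2 by ring] at this
    · have := ((sqForm_isHomogeneous d).mul (zonal_isHomogeneous y k)).C_mul ((k : ℝ) + 1)
      rwa [show 2 + k = k + 2 by ring] at this

theorem zonal_recurrence {d : ℕ} (hd : 2 ≤ d) (y : Fin d → ℝ) (k : ℕ) :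
    MvPolynomial.C ((k : ℝ) + d - 1) * zonal y (k + 2)
      = MvPolynomial.C (2 * (k : ℝ) + d) * (linForm y * zonal y (k + 1))
        - MvPolynomial.C ((k : ℝ) + 1) * (sqForm d * zonal y k) := by
  have hd' : (2 : ℝ) ≤ d := by exact_mod_cast hd
  have hk0 : (0 : ℝ) ≤ k := by positivity
  rw [zonal, ← mul_assoc, ← map_mul, mul_one_div_cancel (by linarith), map_one, one_mul]

theorem C_mul_cancel {d : ℕ} {c : ℝ} (hc : c ≠ 0) {f g : MvPolynomial (Fin d) ℝ}
    (h : MvPolynomial.C c * f = MvPolynomial.C c * g) : f = g :=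
  mul_left_cancel₀ (by simpa using hc) h

theorem dirDeriv_zonal {d : ℕ} (hd : 2 ≤ d) {y : Fin d → ℝ} (hy : ∑ i, y i ^ 2 = 1) :
    ∀ k, dirDeriv y (zonal y (k + 1)) = MvPolynomial.C ((k : ℝ) + 1) * zonal y k
  | 0 => by simp [zonal, dirDeriv_linForm hy]
  | 1 => by
    have hd' : (2 : ℝ) ≤ d := by exact_mod_cast hd
    have h := congrArg (dirDeriv y) (zonal_recurrence hd y 0)
    have z1 : zonal y (0 + 1) = linForm y := rfl
    have z0 : zonal y 0 = 1 := rfl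
    simp only [dirDeriv_sub, dirDeriv_C, zero_mul, zero_add, dirDeriv_mul, z1, z0, dirDeriv_linForm hy,
      dirDeriv_sqForm] at h
    have h1 : dirDeriv y (1 : MvPolynomial (Fin d) ℝ) = 0 := by simp [dirDeriv]
    refine C_mul_cancel (c := ((0 : ℕ) : ℝ) + d - 1) (by push_cast; linarith) ?_
    change _ = _ * (_ * linForm y)
    refine h.trans ?_
    rw [h1]
    simp only [map_sub, map_add, map_mul, map_natCast, map_ofNat, map_one]
    push_cast
    ring
  | k + 2 => by
    have hd' : (2 : ℝ) ≤ d := by exact_mod_cast hd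
    have hk0 : (0 : ℝ) ≤ k := by positivity
    have h := congrArg (dirDeriv y) (zonal_recurrence hd y (k + 1))
    have h2 := zonal_recurrence hd y k
    simp only [dirDeriv_sub, dirDeriv_C, zero_mul, zero_add, dirDeriv_mul, dirDeriv_linForm hy,
      dirDeriv_sqForm, dirDeriv_zonal hd hy (k + 1), dirDeriv_zonal hd hy k] at h
    refine C_mul_cancel (c := ((k + 1 : ℕ) : ℝ) + d - 1) (by push_cast; linarith) ?_
    rw [h]
    simp only [map_sub, map_add, map_mul, map_natCast, map_ofNat, map_one] at h2 ⊢
    push_cast at h2 ⊢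
    rw [show k + 1 + 1 = k + 2 from rfl]
    linear_combination -((k : MvPolynomial (Fin d) ℝ) + 2) * h2

theorem isHarm_zonal {d : ℕ} (hd : 2 ≤ d) {y : Fin d → ℝ} (hy : ∑ i, y i ^ 2 = 1) (k : ℕ) :
    IsHarm k (zonal y k) := by
  refine ⟨zonal_isHomogeneous y k, ?_⟩
  change laplacian (zonal y k) = 0
  have h : laplacian (zonal y k) = 0 ∧ laplacian (zonal y (k + 1)) = 0 := by
    induction k with
    | zero => simp [zonal, laplacian, pderiv_linForm]
    | succ k ih =>
      refine ⟨ih.2, ?_⟩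
      have hd' : (2 : ℝ) ≤ d := by exact_mod_cast hd
      have hk0 : (0 : ℝ) ≤ k := by positivity
      have h := congrArg laplacian (zonal_recurrence hd y k)
      simp only [laplacian_sub, laplacian_C_mul, laplacian_linForm_mul,
        laplacian_sqForm_mul (zonal_isHomogeneous y k), ih.1, ih.2,
        dirDeriv_zonal hd hy k] at h
      refine C_mul_cancel (c := (k : ℝ) + d - 1) (by linarith) ?_
      rw [h]
      simp only [map_add, map_mul, map_natCast, map_ofNat, map_one]
      ring
  exact h.1

theorem eval_zonal {d : ℕ} (y x : Fin d → ℝ) (hx : ∑ i, x i ^ 2 = 1) :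
    ∀ k, MvPolynomial.eval x (zonal y k) = (legendre d k).eval (∑ i, y i * x i)
  | 0 => by simp [zonal, legendre]
  | 1 => by simp [zonal, legendre, linForm]
  | k + 2 => by
    simp [zonal, legendre, linForm, sqForm, hx, eval_zonal y x hx k, eval_zonal y x hx (k + 1)]

theorem legendre_eval_one {d : ℕ} (hd : 2 ≤ d) : ∀ k, (legendre d k).eval 1 = 1
  | 0 => by simp [legendre]
  | 1 => by simp [legendre]
  | k + 2 => by
    have hd' : (2 : ℝ) ≤ d := by exact_mod_cast hd
    have hk0 : (0 : ℝ) ≤ k := by positivity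
    have : (k : ℝ) + d - 1 ≠ 0 := by linarith
    simp [legendre, legendre_eval_one hd k, legendre_eval_one hd (k + 1)]
    field_simp
    ring

theorem legendre_degree {d : ℕ} (hd : 2 ≤ d) :
    ∀ k, (legendre d k).natDegree = k ∧ 0 < (legendre d k).leadingCoeff
  | 0 => by simp [legendre]
  | 1 => by simp [legendre]
  | k + 2 => by
    have hd' : (2 : ℝ) ≤ d := by exact_mod_cast hd
    have hk0 : (0 : ℝ) ≤ k := by positivity
    have hc : (0 : ℝ) < 1 / ((k : ℝ) + d - 1) := one_div_pos.2 (by linarith)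
    have hc2 : (0 : ℝ) < 2 * (k : ℝ) + d := by linarith
    obtain ⟨h1, h1'⟩ := legendre_degree hd (k + 1)
    obtain ⟨h0, h0'⟩ := legendre_degree hd k
    have hA : (Polynomial.C (2 * (k : ℝ) + d) * (Polynomial.X * legendre d (k + 1))).natDegree
        = k + 2 := by
      rw [Polynomial.natDegree_C_mul hc2.ne', Polynomial.natDegree_X_mul, h1]
      rintro h; simp [h] at h1'
    have hB : (Polynomial.C ((k : ℝ) + 1) * legendre d k).natDegree < k + 2 := by
      rw [Polynomial.natDegree_C_mul (by positivity), h0]; omega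
    have hAB : (Polynomial.C (2 * (k : ℝ) + d) * (Polynomial.X * legendre d (k + 1))
        - Polynomial.C ((k : ℝ) + 1) * legendre d k).natDegree = k + 2 := by
      rw [Polynomial.natDegree_sub_eq_left_of_natDegree_lt (by rw [hA]; exact hB), hA]
    rw [legendre]
    refine ⟨by rw [Polynomial.natDegree_C_mul hc.ne', hAB], ?_⟩
    rw [Polynomial.leadingCoeff_mul, Polynomial.leadingCoeff_C,
      Polynomial.leadingCoeff_sub_of_degree_lt, Polynomial.leadingCoeff_mul,
      Polynomial.leadingCoeff_mul, Polynomial.leadingCoeff_C, Polynomial.leadingCoeff_X]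
    · positivity
    · apply Polynomial.degree_lt_degree; rw [hA]; exact hB

theorem sphDim_add_two (e k : ℕ) :
    sphDim (e + 2) (k + 1) = Nat.choose (e + k + 1) (k + 1) + Nat.choose (e + k) k ∧
    (k + 1) * sphDim (e + 2) (k + 1) = (e + 2 * k + 2) * Nat.choose (e + k) k := by
  have h := Nat.add_one_mul_choose_eq (e + k) k
  have h2 : (e + 2 * k + 2) * Nat.choose (e + k) k
      = (k + 1) * (Nat.choose (e + k + 1) (k + 1) + Nat.choose (e + k) k) := by
    linear_combination h
  have h1 : sphDim (e + 2) (k + 1)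
      = Nat.choose (e + k + 1) (k + 1) + Nat.choose (e + k) k := by
    rcases k with _ | k
    · simp [sphDim]
    · have e1 : e + 2 + 2 * (k + 1 + 1) - 2 = e + 2 * (k + 1) + 2 := by omega
      have e2 : e + 2 + (k + 1 + 1) - 3 = e + (k + 1) := by omega
      simp only [sphDim, e1, e2, Nat.add_sub_cancel]
      rw [if_neg (by omega), if_neg (by omega), h2, Nat.mul_div_cancel_left _ (by omega)]
  exact ⟨h1, by rw [h1, h2]⟩

theorem sphDim_recurrence {d : ℕ} (hd : 2 ≤ d) (k : ℕ) :
    (sphDim d (k + 2) : ℝ) * ((2 * k + d) * (k + 2))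
      = sphDim d (k + 1) * ((k + d - 1) * (d + 2 * k + 2)) := by
  obtain ⟨e, rfl⟩ : ∃ e, d = e + 2 := ⟨d - 2, by omega⟩
  have h1 : ((k : ℝ) + 2) * sphDim (e + 2) (k + 2)
      = (e + 2 * k + 4) * Nat.choose (e + k + 1) (k + 1) := by
    have := (sphDim_add_two e (k + 1)).2
    rw [show e + (k + 1) = e + k + 1 by ring] at this
    have := congrArg (Nat.cast (R := ℝ)) this
    push_cast at this
    linear_combination this
  have h2 : ((k : ℝ) + 1) * sphDim (e + 2) (k + 1)
      = (e + 2 * k + 2) * Nat.choose (e + k) k := by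
    exact_mod_cast (sphDim_add_two e k).2
  have h3 : ((e : ℝ) + k + 1) * Nat.choose (e + k) k
      = Nat.choose (e + k + 1) (k + 1) * (k + 1) := by
    exact_mod_cast Nat.add_one_mul_choose_eq (e + k) k
  have hk : (k : ℝ) + 1 ≠ 0 := by positivity
  refine mul_left_cancel₀ hk ?_
  push_cast
  linear_combination ((k : ℝ) + 1) * (2 * k + (e + 2)) * h1
    - ((k : ℝ) + (e + 2) - 1) * ((e + 2) + 2 * k + 2) * h2
    - (2 * k + (e + 2)) * ((e : ℝ) + 2 * k + 4) * h3

theorem sphDim_pos {d : ℕ} (hd : 2 ≤ d) (k : ℕ) : 0 < sphDim d k := by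
  rcases k with _ | k
  · simp [sphDim]
  · obtain ⟨e, rfl⟩ : ∃ e, d = e + 2 := ⟨d - 2, by omega⟩
    rw [(sphDim_add_two e k).1]
    have := Nat.choose_pos (n := e + k) (k := k) (by omega)
    omega

theorem dirDeriv_isHarm {d k : ℕ} (y : Fin d → ℝ) {f : MvPolynomial (Fin d) ℝ}
    (hf : IsHarm (k + 1) f) : IsHarm k (dirDeriv y f) :=
  IsHarm.sum _ _ fun i _ => (hf.pderiv i).C_mul (y i)

theorem eval_dirDeriv_self {d k : ℕ} (y : Fin d → ℝ) {f : MvPolynomial (Fin d) ℝ}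
    (hf : IsHarm (k + 1) f) :
    MvPolynomial.eval y (dirDeriv y f) = ((k : ℝ) + 1) * MvPolynomial.eval y f := by
  have h := congrArg (MvPolynomial.eval y) hf.homogeneous.sum_X_mul_pderiv
  simpa [dirDeriv] using h

theorem polyInt_sub {d : ℕ} {σ : Measure (EuclideanSpace ℝ (Fin d))} (hσ : IsSphereLaw σ)
    (f g : MvPolynomial (Fin d) ℝ) : polyInt σ (f - g) = polyInt σ f - polyInt σ g :=
  map_sub (polyIntL hσ) f g

theorem polyInt_sum {d : ℕ} {σ : Measure (EuclideanSpace ℝ (Fin d))} (hσ : IsSphereLaw σ)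
    {ι : Type*} (s : Finset ι) (f : ι → MvPolynomial (Fin d) ℝ) :
    polyInt σ (∑ i ∈ s, f i) = ∑ i ∈ s, polyInt σ (f i) :=
  map_sum (polyIntL hσ) f s

theorem polyInt_linForm_mul {d m : ℕ} {σ : Measure (EuclideanSpace ℝ (Fin d))}
    (hσ : IsSphereLaw σ) (y : Fin d → ℝ) {f : MvPolynomial (Fin d) ℝ} (hf : f.IsHomogeneous m) :
    ((d : ℝ) + m - 1) * polyInt σ (linForm y * f) = polyInt σ (dirDeriv y f) := by
  rw [linForm, dirDeriv, Finset.sum_mul, polyInt_sum hσ, polyInt_sum hσ, Finset.mul_sum]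
  refine Finset.sum_congr rfl fun i _ => ?_
  rw [mul_assoc, polyInt_C_mul, polyInt_C_mul, ← polyInt_X_mul hσ hf i]
  ring

/-- Reproducing property of zonal harmonics. -/
theorem zonal_reproducing {d : ℕ} (hd : 2 ≤ d) {σ : Measure (EuclideanSpace ℝ (Fin d))}
    (hσ : IsSphereLaw σ) {y : Fin d → ℝ} (hy : ∑ i, y i ^ 2 = 1) :
    ∀ (k : ℕ) {f : MvPolynomial (Fin d) ℝ}, IsHarm k f →
      (sphDim d k : ℝ) * polyInt σ (zonal y k * f) = MvPolynomial.eval y f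
  | 0, f, hf => by
    have := hσ.prob
    have h := hf.homogeneous
    rw [← MvPolynomial.totalDegree_zero_iff_isHomogeneous,
      MvPolynomial.totalDegree_eq_zero_iff_eq_C] at h
    rw [h]
    simp [zonal, polyInt, sphDim]
  | 1, f, hf => by
    have h := polyInt_linForm_mul hσ y hf.homogeneous
    have h2 := zonal_reproducing hd hσ hy 0 (dirDeriv_isHarm y hf)
    have h3 := eval_dirDeriv_self y hf
    simp only [zonal, sphDim, one_mul] at h2 ⊢
    push_cast at h h2 h3
    norm_num at h h2 h3 ⊢
    rw [h, h2, h3]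
  | k + 2, f, hf => by
    have hd' : (2 : ℝ) ≤ d := by exact_mod_cast hd
    have hk0 : (0 : ℝ) ≤ k := by positivity
    have hz := isHarm_zonal hd hy
    have h1 := polyInt_linForm_mul hσ y ((hz (k + 1)).homogeneous.mul hf.homogeneous)
    rw [dirDeriv_mul, polyInt_add hσ, dirDeriv_zonal hd hy, mul_assoc, polyInt_C_mul,
      mul_comm (zonal y k), hf.orthogonal hd hσ (hz k) (by omega), mul_zero, zero_add] at h1
    have h2 := zonal_reproducing hd hσ hy (k + 1) (dirDeriv_isHarm y hf)
    rw [eval_dirDeriv_self y hf] at h2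
    have h3 := congrArg (fun u => polyInt σ (u * f)) (zonal_recurrence hd y k)
    simp only [sub_mul, mul_assoc, polyInt_sub hσ, polyInt_C_mul] at h3
    have h4 : polyInt σ (sqForm d * (zonal y k * f)) = 0 := by
      rw [sqForm, polyInt_sum_sq_mul hσ, mul_comm, hf.orthogonal hd hσ (hz k) (by omega)]
    rw [h4] at h3
    have h5 := sphDim_recurrence hd k
    push_cast at h1 h2 h3
    refine mul_left_cancel₀ (b := (sphDim d (k + 2) : ℝ) * polyInt σ (zonal y (k + 2) * f))
      (a := ((k : ℝ) + d - 1) * (d + 2 * k + 2) * (k + 2)) ?_ ?_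
    · have : (k : ℝ) + d - 1 ≠ 0 := by linarith
      positivity
    · linear_combination ((d : ℝ) + 2 * k + 2) * (k + 2) * sphDim d (k + 2) * h3
        + (k + 2) * sphDim d (k + 2) * (2 * (k : ℝ) + d) * h1
        + polyInt σ (zonal y (k + 1) * dirDeriv y f) * h5
        + (k + d - 1) * (d + 2 * k + 2) * h2

theorem sum_sq_eq_norm {d : ℕ} (x : EuclideanSpace ℝ (Fin d)) : ∑ i, x i ^ 2 = ‖x‖ ^ 2 := by
  rw [EuclideanSpace.real_norm_sq_eq]

theorem sum_sq_of_norm {d : ℕ} {x : EuclideanSpace ℝ (Fin d)} (hx : ‖x‖ = 1) :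
    ∑ i, x i ^ 2 = 1 := by
  rw [sum_sq_eq_norm, hx, one_pow]

/-- The combination `∑ i, b i • Z_{w i}` of zonal harmonics. -/
def zonalComb {d : ℕ} {ι : Type*} [Fintype ι] (k : ℕ) (w : ι → EuclideanSpace ℝ (Fin d))
    (b : ι → ℝ) : MvPolynomial (Fin d) ℝ :=
  ∑ i, MvPolynomial.C (b i) * zonal (fun l => w i l) k

/-- The zonal kernel `P_k(⟨u, v⟩)`. -/
def zker {d : ℕ} (k : ℕ) (u v : EuclideanSpace ℝ (Fin d)) : ℝ := (legendre d k).eval (dotp u v)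

theorem dotp_comm {d : ℕ} (u v : EuclideanSpace ℝ (Fin d)) : dotp u v = dotp v u :=
  Finset.sum_congr rfl fun _ _ => mul_comm _ _

theorem zker_comm {d k : ℕ} (u v : EuclideanSpace ℝ (Fin d)) : zker k u v = zker k v u := by
  rw [zker, zker, dotp_comm]

theorem zker_self {d k : ℕ} (hd : 2 ≤ d) {u : EuclideanSpace ℝ (Fin d)} (hu : ‖u‖ = 1) :
    zker k u u = 1 := by
  have : dotp u u = 1 := by
    rw [← sum_sq_of_norm hu]; exact Finset.sum_congr rfl fun _ _ => (sq _).symm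
  rw [zker, this, legendre_eval_one hd]

theorem eval_zonal_eq_zker {d k : ℕ} {u v : EuclideanSpace ℝ (Fin d)} (hv : ‖v‖ = 1) :
    MvPolynomial.eval (fun i => v i) (zonal (fun i => u i) k) = zker k u v :=
  eval_zonal _ _ (sum_sq_of_norm hv) k

theorem eval_zonalComb {d k : ℕ} {ι : Type*} [Fintype ι] (w : ι → EuclideanSpace ℝ (Fin d))
    (b : ι → ℝ) {x : EuclideanSpace ℝ (Fin d)} (hx : ‖x‖ = 1) :
    MvPolynomial.eval (fun i => x i) (zonalComb k w b) = ∑ i, b i * zker k (w i) x := by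
  simp [zonalComb, eval_zonal_eq_zker hx]

theorem isHarm_zonalComb {d k : ℕ} (hd : 2 ≤ d) {ι : Type*} [Fintype ι]
    {w : ι → EuclideanSpace ℝ (Fin d)} (hw : ∀ i, ‖w i‖ = 1) (b : ι → ℝ) :
    IsHarm k (zonalComb k w b) :=
  IsHarm.sum _ _ fun i _ => (isHarm_zonal hd (sum_sq_of_norm (hw i)) k).C_mul _

/-- The Gram form of zonal harmonics is the `L²` norm of the combination. -/
theorem polyInt_zonalComb_sq {d k : ℕ} (hd : 2 ≤ d) {σ : Measure (EuclideanSpace ℝ (Fin d))}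
    (hσ : IsSphereLaw σ) {ι : Type*} [Fintype ι]
    {w : ι → EuclideanSpace ℝ (Fin d)} (hw : ∀ i, ‖w i‖ = 1) (b : ι → ℝ) :
    (sphDim d k : ℝ) * polyInt σ (zonalComb k w b ^ 2)
      = ∑ i, ∑ j, b i * b j * zker k (w i) (w j) := by
  rw [sq]
  conv_lhs => enter [2, 2, 1]; rw [zonalComb]
  rw [Finset.sum_mul, polyInt_sum hσ, Finset.mul_sum]
  refine Finset.sum_congr rfl fun i _ => ?_
  rw [mul_assoc, polyInt_C_mul, mul_left_comm,
    zonal_reproducing hd hσ (sum_sq_of_norm (hw i)) k (isHarm_zonalComb hd hw b),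
    eval_zonalComb w b (hw i), Finset.mul_sum]
  refine Finset.sum_congr rfl fun j _ => ?_
  rw [zker_comm (w i)]; ring

theorem gramForm_nonneg {d k : ℕ} (hd : 2 ≤ d) {σ : Measure (EuclideanSpace ℝ (Fin d))}
    (hσ : IsSphereLaw σ) {ι : Type*} [Fintype ι]
    {w : ι → EuclideanSpace ℝ (Fin d)} (hw : ∀ i, ‖w i‖ = 1) (b : ι → ℝ) :
    0 ≤ ∑ i, ∑ j, b i * b j * zker k (w i) (w j) := by
  rw [← polyInt_zonalComb_sq hd hσ hw b]
  exact mul_nonneg (by positivity) (polyInt_nonneg fun x => by rw [map_pow]; positivity)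

theorem abs_zker_le_one {d k : ℕ} (hd : 2 ≤ d) {σ : Measure (EuclideanSpace ℝ (Fin d))}
    (hσ : IsSphereLaw σ) {u v : EuclideanSpace ℝ (Fin d)} (hu : ‖u‖ = 1) (hv : ‖v‖ = 1) :
    |zker k u v| ≤ 1 := by
  have hw : ∀ i, ‖(![u, v] : Fin 2 → EuclideanSpace ℝ (Fin d)) i‖ = 1 := by
    intro i; fin_cases i <;> simp [hu, hv]
  have h1 := gramForm_nonneg (k := k) hd hσ hw ![1, 1]
  have h2 := gramForm_nonneg (k := k) hd hσ hw ![1, -1]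
  simp [Fin.sum_univ_two, zker_self hd hu, zker_self hd hv, zker_comm v u] at h1 h2
  rw [abs_le]; constructor <;> linarith

/-- Moments of a zonal combination at a random point of the sphere. -/
theorem integral_zonalComb_pow {d k : ℕ} {σ : Measure (EuclideanSpace ℝ (Fin d))}
    (hσ : IsSphereLaw σ) {ι : Type*} [Fintype ι]
    (w : ι → EuclideanSpace ℝ (Fin d)) (b : ι → ℝ) (m : ℕ) :
    ∫ x, (∑ i, b i * zker k (w i) x) ^ m ∂σ = polyInt σ (zonalComb k w b ^ m) := by
  refine integral_congr_ae ?_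
  filter_upwards [hσ.norm_eq_one] with x hx
  rw [map_pow, eval_zonalComb w b hx]

theorem integral_gramForm_pow_le {d k : ℕ} (hd : 2 ≤ d)
    {σ : Measure (EuclideanSpace ℝ (Fin d))}
    (hσ : IsSphereLaw σ) {ι : Type*} [Fintype ι]
    {w : ι → EuclideanSpace ℝ (Fin d)} (hw : ∀ i, ‖w i‖ = 1) (b : ι → ℝ) (q : ℕ) :
    ∫ x, (∑ i, b i * zker k (w i) x) ^ (2 * (q + 2)) ∂σ
      ≤ ((2 * (q : ℝ) + 3) ^ k *
        ((∑ i, ∑ j, b i * b j * zker k (w i) (w j)) / sphDim d k)) ^ (q + 2) := by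
  have hN : (sphDim d k : ℝ) ≠ 0 := by exact_mod_cast (sphDim_pos hd k).ne'
  rw [integral_zonalComb_pow hσ, ← polyInt_zonalComb_sq hd hσ hw b, mul_div_cancel_left₀ _ hN]
  exact IsHarm.hypercontractive (by omega) hσ q k (isHarm_zonalComb hd hw b)

theorem integral_zker_sq {d k : ℕ} (hd : 2 ≤ d) {σ : Measure (EuclideanSpace ℝ (Fin d))}
    (hσ : IsSphereLaw σ) {u : EuclideanSpace ℝ (Fin d)} (hu : ‖u‖ = 1) :
    ∫ x, zker k u x ^ 2 ∂σ = 1 / sphDim d k := by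
  have hN : (sphDim d k : ℝ) ≠ 0 := by exact_mod_cast (sphDim_pos hd k).ne'
  have h := polyInt_zonalComb_sq (k := k) hd hσ (w := fun _ : Unit => u) (fun _ => hu) fun _ => 1
  rw [← integral_zonalComb_pow hσ] at h
  simp [zker_self hd hu] at h
  field_simp
  linarith

theorem integral_zker_mul_of_ne {d k l : ℕ} (hd : 2 ≤ d)
    {σ : Measure (EuclideanSpace ℝ (Fin d))}
    (hσ : IsSphereLaw σ) {u : EuclideanSpace ℝ (Fin d)} (hu : ‖u‖ = 1) (hkl : k ≠ l) :
    ∫ x, zker k u x * zker l u x ∂σ = 0 := by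
  have h : ∀ k l, ∫ x, zker k u x * zker l u x ∂σ
      = polyInt σ (zonal (fun i => u i) k * zonal (fun i => u i) l) := by
    intro k l
    refine integral_congr_ae ?_
    filter_upwards [hσ.norm_eq_one] with x hx
    rw [map_mul, eval_zonal_eq_zker hx, eval_zonal_eq_zker hx]
  have hz := isHarm_zonal hd (sum_sq_of_norm hu)
  rcases lt_or_gt_of_ne hkl with h1 | h1
  · rw [h, mul_comm]; exact (hz l).orthogonal hd hσ (hz k) h1
  · rw [h]; exact (hz k).orthogonal hd hσ (hz l) h1

theorem sphereUniform_sqrt_ne_zero {d k : ℕ} {q : Polynomial ℝ} (hq : IsGegenbauer d k q) :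
    sphereUniform d (Real.sqrt d) ≠ 0 := by
  intro h
  have := hq.2.2.1
  rw [tau1, h, Measure.map_zero, integral_zero_measure] at this
  exact zero_ne_one this

theorem nnnorm_sqrt_rpow_ne_zero {d : ℕ} (hd : 0 < d) :
    ((‖Real.sqrt d‖₊ ^ ((d : ℝ) - 1) : NNReal) : ENNReal) ≠ 0 := by
  have h0 : 0 < ‖Real.sqrt d‖₊ :=
    nnnorm_pos.2 (Real.sqrt_pos.2 (by exact_mod_cast hd)).ne'
  rw [ENNReal.coe_ne_zero]
  exact (NNReal.rpow_pos h0).ne'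

open scoped Pointwise in
theorem hausdorffMeasure_sphere_sqrt {d : ℕ} (hd : 0 < d) (A : Set (EuclideanSpace ℝ (Fin d))) :
    (Measure.hausdorffMeasure ((d : ℝ) - 1) : Measure (EuclideanSpace ℝ (Fin d)))
        (Real.sqrt d • A)
      = ((‖Real.sqrt d‖₊ ^ ((d : ℝ) - 1) : NNReal) : ENNReal) *
        (Measure.hausdorffMeasure ((d : ℝ) - 1) : Measure (EuclideanSpace ℝ (Fin d))) A := by
  have h1 : (1 : ℝ) ≤ d := by exact_mod_cast hd
  have h0 : Real.sqrt d ≠ 0 := (Real.sqrt_pos.2 (by linarith)).ne'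
  rw [Measure.hausdorffMeasure_smul₀ (by linarith) h0]
  rfl

open scoped Pointwise in
theorem smul_unit_sphere_sqrt {d : ℕ} (hd : 0 < d) :
    Real.sqrt d • Metric.sphere (0 : EuclideanSpace ℝ (Fin d)) 1
      = Metric.sphere 0 (Real.sqrt d) := by
  have h0 : Real.sqrt d ≠ 0 := (Real.sqrt_pos.2 (by exact_mod_cast hd)).ne'
  rw [smul_sphere' h0, smul_zero, mul_one, Real.norm_of_nonneg (Real.sqrt_nonneg _)]

theorem sphere_measure_ne {d k : ℕ} (hd : 0 < d) {q : Polynomial ℝ} (hq : IsGegenbauer d k q) :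
    (Measure.hausdorffMeasure ((d : ℝ) - 1) : Measure (EuclideanSpace ℝ (Fin d)))
        (Metric.sphere 0 1) ≠ 0 ∧
    (Measure.hausdorffMeasure ((d : ℝ) - 1) : Measure (EuclideanSpace ℝ (Fin d)))
        (Metric.sphere 0 1) ≠ ⊤ := by
  have h := sphereUniform_sqrt_ne_zero hq
  rw [sphereUniform, ← smul_unit_sphere_sqrt hd, hausdorffMeasure_sphere_sqrt hd] at h
  have hc := nnnorm_sqrt_rpow_ne_zero hd
  constructor
  · intro h0
    refine h ?_
    rw [Measure.restrict_eq_zero.2 (by rw [hausdorffMeasure_sphere_sqrt hd, h0, mul_zero]),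
      smul_zero]
  · intro h0
    refine h ?_
    rw [h0, ENNReal.mul_top hc, ENNReal.inv_top, zero_smul]

theorem sphereUniform_isSphereLaw {d k : ℕ} (hd : 0 < d) {q : Polynomial ℝ}
    (hq : IsGegenbauer d k q) : IsSphereLaw (sphereUniform d 1) := by
  obtain ⟨h0, ht⟩ := sphere_measure_ne hd hq
  refine ⟨⟨?_⟩, ?_, ?_⟩
  · rw [sphereUniform, Measure.smul_apply, Measure.restrict_apply_univ, smul_eq_mul,
      ENNReal.inv_mul_cancel h0 ht]
  · refine Measure.ae_smul_measure ?_ _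
    filter_upwards [ae_restrict_mem Metric.isClosed_sphere.measurableSet] with x hx
    simpa using hx
  · intro R
    have hR := R.toIsometryEquiv.measurePreserving_hausdorffMeasure ((d : ℝ) - 1)
    have h2 : R ⁻¹' Metric.sphere 0 1 = Metric.sphere 0 1 := by ext x; simp
    rw [sphereUniform, Measure.map_smul]
    congr 1
    have h3 := (hR.restrict_preimage
      (Metric.isClosed_sphere (x := (0 : EuclideanSpace ℝ (Fin d))) (ε := 1)).measurableSet).map_eq
    change Measure.map R (Measure.restrict _ (R ⁻¹' Metric.sphere 0 1)) = _ at h3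
    rwa [h2] at h3

open scoped Pointwise in
theorem sphereUniform_sqrt_eq_map {d : ℕ} (hd : 0 < d) :
    sphereUniform d (Real.sqrt d) = (sphereUniform d 1).map fun x => Real.sqrt d • x := by
  have h0 : Real.sqrt d ≠ 0 := (Real.sqrt_pos.2 (by exact_mod_cast hd)).ne'
  have hc := nnnorm_sqrt_rpow_ne_zero hd
  have hm : Measurable fun x : EuclideanSpace ℝ (Fin d) => Real.sqrt d • x :=
    measurable_const_smul _
  ext A hA
  have hA' : A ∩ Metric.sphere 0 (Real.sqrt d)
      = Real.sqrt d • (((fun x => Real.sqrt d • x) ⁻¹' A) ∩ Metric.sphere 0 1) := by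
    rw [Set.smul_set_inter₀ h0, smul_unit_sphere_sqrt hd]
    congr 1
    ext x
    rw [Set.mem_smul_set_iff_inv_smul_mem₀ h0]
    simp [smul_inv_smul₀ h0]
  rw [Measure.map_apply hm hA, sphereUniform, sphereUniform, Measure.smul_apply,
    Measure.smul_apply, Measure.restrict_apply hA, Measure.restrict_apply (hm hA), hA',
    hausdorffMeasure_sphere_sqrt hd, ← smul_unit_sphere_sqrt hd, hausdorffMeasure_sphere_sqrt hd,
    smul_eq_mul, smul_eq_mul, ENNReal.mul_inv (Or.inl hc) (Or.inl ENNReal.coe_ne_top),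
    mul_mul_mul_comm, ENNReal.inv_mul_cancel hc ENNReal.coe_ne_top, one_mul]

theorem integral_tau1 {d : ℕ} (hd : 0 < d) {f : ℝ → ℝ} (hf : Continuous f) :
    ∫ s, f s ∂tau1 d = ∫ x, f (Real.sqrt d * x ⟨0, hd⟩) ∂sphereUniform d 1 := by
  have h1 : Measurable fun x : EuclideanSpace ℝ (Fin d) => x ⟨0, hd⟩ := by fun_prop
  have hm : Measurable fun x : EuclideanSpace ℝ (Fin d) => Real.sqrt d • x :=
    measurable_const_smul _
  simp only [tau1, dif_pos hd]
  rw [integral_map h1.aemeasurable hf.aestronglyMeasurable, sphereUniform_sqrt_eq_map hd,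
    integral_map hm.aemeasurable (by fun_prop : Continuous fun x : EuclideanSpace ℝ (Fin d) =>
      f (x ⟨0, hd⟩)).aestronglyMeasurable]
  rfl

/-- Points on the sphere of radius `√d` are rescaled points of the unit sphere. -/
theorem lintegral_Xmeas_le {d k n : ℕ} (hd : 0 < d) {q : Polynomial ℝ}
    (hq : IsGegenbauer d k q) (r : ℝ) (N : ℕ) :
    ∫⁻ x, ENNReal.ofReal (opNorm (QXmat d n q N x) ^ r) ∂Xmeas d n
      ≤ ∫⁻ w, ENNReal.ofReal (opNorm (QWmat d n q N w) ^ r) ∂Wmeas d n := by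
  have hσ := sphereUniform_isSphereLaw hd hq
  have := hσ.prob
  have hm : Measurable fun x : EuclideanSpace ℝ (Fin d) => Real.sqrt d • x :=
    measurable_const_smul _
  have hs : Real.sqrt d ≠ 0 := (Real.sqrt_pos.2 (by exact_mod_cast hd)).ne'
  have hX : Xmeas d n = (Wmeas d n).map fun w i => Real.sqrt d • w i := by
    rw [Xmeas, Wmeas, sphereUniform_sqrt_eq_map hd]
    have : IsProbabilityMeasure ((sphereUniform d 1).map fun x => Real.sqrt d • x) :=
      Measure.isProbabilityMeasure_map hm.aemeasurable
    exact (Measure.pi_map_pi fun _ => hm.aemeasurable).symm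
  rw [hX]
  refine (lintegral_map_le _ _).trans (le_of_eq ?_)
  refine lintegral_congr fun w => ?_
  congr 3
  ext i j
  have : dotp (Real.sqrt d • w i) (Real.sqrt d • w j) / Real.sqrt d
      = Real.sqrt d * dotp (w i) (w j) := by
    rw [div_eq_iff hs, dotp, dotp, Finset.mul_sum, Finset.sum_mul]
    refine Finset.sum_congr rfl fun l _ => ?_
    simp only [PiLp.smul_apply, smul_eq_mul]
    ring
  simp only [QXmat, QWmat, Matrix.of_apply, this]

/-- A polynomial is a combination of Legendre polynomials. -/
theorem exists_legendre_expansion {d : ℕ} (hd : 2 ≤ d) :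
    ∀ (k : ℕ) (q : Polynomial ℝ), q.natDegree ≤ k →
      ∃ a : ℕ → ℝ, q = ∑ j ∈ Finset.range (k + 1), Polynomial.C (a j) * legendre d j
  | 0, q, hq => ⟨fun _ => q.coeff 0, by
      simpa [legendre] using Polynomial.eq_C_of_natDegree_le_zero hq⟩
  | k + 1, q, hq => by
    obtain ⟨h1, h2⟩ := legendre_degree hd (k + 1)
    set P := legendre d (k + 1)
    set c := q.coeff (k + 1) / P.leadingCoeff with hc
    have h3 : (q - Polynomial.C c * P).natDegree ≤ k := by
      rw [Polynomial.natDegree_le_iff_coeff_eq_zero]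
      intro m hm
      rw [Polynomial.coeff_sub, Polynomial.coeff_C_mul]
      rcases Nat.lt_or_ge (k + 1) m with h | h
      · rw [Polynomial.coeff_eq_zero_of_natDegree_lt (by omega),
          Polynomial.coeff_eq_zero_of_natDegree_lt (p := P) (by omega), mul_zero, sub_zero]
      · have : m = k + 1 := by omega
        subst this
        have : P.coeff (k + 1) = P.leadingCoeff := by rw [Polynomial.leadingCoeff, h1]
        rw [this, hc, div_mul_cancel₀ _ h2.ne', sub_self]
    obtain ⟨a, ha⟩ := exists_legendre_expansion hd k _ h3
    refine ⟨Function.update a (k + 1) c, ?_⟩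
    rw [Finset.sum_range_succ, Function.update_self, ← sub_eq_iff_eq_add, ha]
    refine Finset.sum_congr rfl fun j hj => ?_
    rw [Function.update_of_ne (by simp at hj; omega)]

/-- The Gegenbauer polynomial is a rescaled Legendre polynomial. -/
theorem IsGegenbauer.eval_eq {d k : ℕ} (hd : 2 ≤ d) {q : Polynomial ℝ}
    (hq : IsGegenbauer d k q) (t : ℝ) :
    q.eval (Real.sqrt d * t) = Real.sqrt (sphDim d k) * (legendre d k).eval t := by
  have hd0 : 0 < d := by omega
  have hs : 0 < Real.sqrt d := Real.sqrt_pos.2 (by exact_mod_cast hd0)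
  have hσ := sphereUniform_isSphereLaw hd0 hq
  set σ := sphereUniform d 1
  set e : EuclideanSpace ℝ (Fin d) := EuclideanSpace.single ⟨0, hd0⟩ 1 with he
  have hen : ‖e‖ = 1 := by simp [he]
  have hdot : ∀ x, dotp e x = x ⟨0, hd0⟩ := by
    intro x; simp [dotp, he, PiLp.single_apply]
  have hcont : ∀ k, Continuous fun x => zker k e x := by
    intro k
    simp only [zker, hdot]
    exact (legendre d k).continuous.comp (by fun_prop)
  obtain ⟨hdeg, hlc, hone, horth⟩ := hq
  set Q := q.comp (Polynomial.C (Real.sqrt d) * Polynomial.X) with hQ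
  have hlin : (Polynomial.C (Real.sqrt d) * Polynomial.X).natDegree = 1 :=
    Polynomial.natDegree_C_mul_X _ hs.ne'
  have hQd : Q.natDegree = k := by
    rw [hQ, Polynomial.natDegree_comp, hlin, mul_one, hdeg]
  have hQl : 0 < Q.leadingCoeff := by
    rw [hQ, Polynomial.leadingCoeff_comp (by rw [hlin]; exact one_ne_zero),
      Polynomial.leadingCoeff_mul_X, Polynomial.leadingCoeff_C]
    positivity
  have hQe : ∀ t, Q.eval t = q.eval (Real.sqrt d * t) := by intro t; simp [hQ]
  obtain ⟨a, ha⟩ := exists_legendre_expansion hd k Q hQd.le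
  have hQa : ∀ x, q.eval (Real.sqrt d * x ⟨0, hd0⟩)
      = ∑ j ∈ Finset.range (k + 1), a j * zker j e x := by
    intro x
    rw [← hQe, ha]
    simp [Polynomial.eval_finsetSum, zker, hdot]
  have hN : ∀ j, (0 : ℝ) < sphDim d j := fun j => by exact_mod_cast sphDim_pos hd j
  have hproj : ∀ j ∈ Finset.range (k + 1),
      ∫ x, q.eval (Real.sqrt d * x ⟨0, hd0⟩) * zker j e x ∂σ = a j / sphDim d j := by
    intro j hj
    simp only [hQa, Finset.sum_mul, mul_assoc]
    rw [integral_finsetSum]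
    swap
    · intro i _
      have := hcont i
      have := hcont j
      exact hσ.integrable (by fun_prop)
    simp only [integral_const_mul]
    rw [Finset.sum_eq_single_of_mem j hj]
    · simp only [← sq]
      rw [integral_zker_sq hd hσ hen, mul_one_div]
    · intro i _ hij
      rw [integral_zker_mul_of_ne hd hσ hen hij, mul_zero]
  have hlow : ∀ g : Polynomial ℝ, g.natDegree < k →
      ∫ s, q.eval s * g.eval s ∂tau1 d = 0 := by
    intro g hg
    rw [integral_tau1 hd0 (f := fun s => q.eval s * g.eval s)
      (q.continuous.mul g.continuous)]
    simp only [g.eval_eq_sum_range, Finset.mul_sum]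
    rw [integral_finsetSum _ fun i _ => hσ.integrable ?_]
    · refine Finset.sum_eq_zero fun j hj => ?_
      have := horth j (by simp at hj; omega)
      rw [integral_tau1 hd0 (f := fun s => q.eval s * s ^ j)
        (q.continuous.mul (continuous_pow j))] at this
      simp only [mul_left_comm _ (g.coeff j)]
      rw [integral_const_mul, this, mul_zero]
    · exact (q.continuous.comp (by fun_prop)).mul (by fun_prop)
  have hzero : ∀ j ∈ Finset.range k, a j = 0 := by
    intro j hj
    have hj' := Finset.mem_range.1 hj
    have h1 := hlow ((legendre d j).comp (Polynomial.C (1 / Real.sqrt d) * Polynomial.X)) (by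
      rw [Polynomial.natDegree_comp, Polynomial.natDegree_C_mul_X _ (by positivity),
        (legendre_degree hd j).1]
      omega)
    rw [integral_tau1 hd0 (f := fun s => q.eval s * Polynomial.eval s _)
      (q.continuous.mul (Polynomial.continuous _))] at h1
    have h2 := hproj j (by simp; omega)
    have h3 : ∀ x : EuclideanSpace ℝ (Fin d),
        ((legendre d j).comp (Polynomial.C (1 / Real.sqrt d) * Polynomial.X)).eval
          (Real.sqrt d * x ⟨0, hd0⟩) = zker j e x := by
      intro x
      rw [zker, hdot, Polynomial.eval_comp]
      congr 1
      simp
      field_simp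
    simp only [h3] at h1
    rw [h1] at h2
    have := hN j
    rcases div_eq_zero_iff.1 h2.symm with h | h
    · exact h
    · linarith
  have hQk : Q = Polynomial.C (a k) * legendre d k := by
    rw [ha, Finset.sum_range_succ, Finset.sum_eq_zero, zero_add]
    intro j hj
    rw [hzero j hj, map_zero, zero_mul]
  have hak : 0 < a k := by
    rw [hQk, Polynomial.leadingCoeff_mul, Polynomial.leadingCoeff_C] at hQl
    exact pos_of_mul_pos_left hQl (legendre_degree hd k).2.le
  have hsq : a k ^ 2 = sphDim d k := by
    rw [integral_tau1 hd0 (f := fun s => q.eval s ^ 2) (q.continuous.pow 2)] at hone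
    have h3 : ∀ x : EuclideanSpace ℝ (Fin d), q.eval (Real.sqrt d * x ⟨0, hd0⟩) ^ 2
        = a k ^ 2 * zker k e x ^ 2 := by
      intro x
      rw [← hQe, hQk, zker, hdot]
      simp [mul_pow]
    simp only [h3] at hone
    rw [integral_const_mul, integral_zker_sq hd hσ hen] at hone
    have := hN k
    field_simp at hone
    exact hone
  rw [← hQe, hQk, Polynomial.eval_mul, Polynomial.eval_C, ← hsq, Real.sqrt_sq hak.le]

/-- The bilinear form of a real square array. -/
def qform {n : ℕ} (G : Fin n → Fin n → ℝ) (a b : Fin n → ℝ) : ℝ :=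
  ∑ i, ∑ j, a i * b j * G i j

/-- Squared Euclidean norm of a vector of coordinates. -/
def sqn {n : ℕ} (a : Fin n → ℝ) : ℝ := ∑ i, a i ^ 2

/-- Correlation arrays: symmetric, positive semidefinite, unit diagonal. -/
structure IsCorr {n : ℕ} (G : Fin n → Fin n → ℝ) : Prop where
  symm : ∀ i j, G i j = G j i
  diag : ∀ i, G i i = 1
  abs_le : ∀ i j, |G i j| ≤ 1
  psd : ∀ a, 0 ≤ qform G a a

theorem sqn_nonneg {n : ℕ} (a : Fin n → ℝ) : 0 ≤ sqn a := Finset.sum_nonneg fun _ _ => sq_nonneg _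

theorem qform_add_left {n : ℕ} (G : Fin n → Fin n → ℝ) (a a' b : Fin n → ℝ) :
    qform G (a + a') b = qform G a b + qform G a' b := by
  simp [qform, add_mul, Finset.sum_add_distrib]

theorem qform_add_right {n : ℕ} (G : Fin n → Fin n → ℝ) (a b b' : Fin n → ℝ) :
    qform G a (b + b') = qform G a b + qform G a b' := by
  simp [qform, mul_add, add_mul, Finset.sum_add_distrib]

theorem qform_smul_left {n : ℕ} (G : Fin n → Fin n → ℝ) (c : ℝ) (a b : Fin n → ℝ) :
    qform G (c • a) b = c * qform G a b := by
  simp only [qform, Pi.smul_apply, smul_eq_mul, Finset.mul_sum, mul_assoc]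

theorem qform_smul_right {n : ℕ} (G : Fin n → Fin n → ℝ) (c : ℝ) (a b : Fin n → ℝ) :
    qform G a (c • b) = c * qform G a b := by
  simp only [qform, Pi.smul_apply, smul_eq_mul, Finset.mul_sum]
  exact Finset.sum_congr rfl fun _ _ => Finset.sum_congr rfl fun _ _ => by ring

theorem IsCorr.qform_comm {n : ℕ} {G : Fin n → Fin n → ℝ} (hG : IsCorr G) (a b : Fin n → ℝ) :
    qform G a b = qform G b a := by
  rw [qform, qform, Finset.sum_comm]
  refine Finset.sum_congr rfl fun i _ => Finset.sum_congr rfl fun j _ => ?_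
  rw [hG.symm j i]; ring

theorem IsCorr.cauchy_schwarz {n : ℕ} {G : Fin n → Fin n → ℝ} (hG : IsCorr G)
    (a b : Fin n → ℝ) : qform G a b ^ 2 ≤ qform G a a * qform G b b := by
  have h : ∀ t : ℝ, 0 ≤ qform G b b * (t * t) + 2 * qform G a b * t + qform G a a := by
    intro t
    have := hG.psd (a + t • b)
    simp only [qform_add_left, qform_add_right, qform_smul_left, qform_smul_right,
      hG.qform_comm b a] at this
    linarith
  have := discrim_le_zero h
  rw [discrim] at this
  linarith

theorem qform_eq_sum_mul {n : ℕ} (G : Fin n → Fin n → ℝ) (a b : Fin n → ℝ) :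
    qform G a b = ∑ i, a i * ∑ j, G i j * b j := by
  simp only [qform, Finset.mul_sum]
  exact Finset.sum_congr rfl fun _ _ => Finset.sum_congr rfl fun _ _ => by ring

theorem toEuclideanLin_of_apply {n : ℕ} (G : Fin n → Fin n → ℝ) (x : EuclideanSpace ℝ (Fin n))
    (i : Fin n) : Matrix.toEuclideanLin (Matrix.of G) x i = ∑ j, G i j * x j := by
  rw [Matrix.toLpLin_apply]
  rfl

theorem opNorm_of_nonneg {n : ℕ} (A : Matrix (Fin n) (Fin n) ℝ) : 0 ≤ opNorm A := norm_nonneg _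

theorem abs_qform_le {n : ℕ} (G : Fin n → Fin n → ℝ) (a b : Fin n → ℝ) :
    |qform G a b| ≤ opNorm (Matrix.of G) * Real.sqrt (sqn a) * Real.sqrt (sqn b) := by
  set T := LinearMap.toContinuousLinearMap (Matrix.toEuclideanLin (Matrix.of G))
  have h1 : qform G a b = inner ℝ (WithLp.toLp 2 a) (T (WithLp.toLp 2 b)) := by
    rw [qform_eq_sum_mul, PiLp.inner_apply]
    refine Finset.sum_congr rfl fun i _ => ?_
    change _ = inner ℝ (a i) (Matrix.toEuclideanLin (Matrix.of G) (WithLp.toLp 2 b) i)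
    rw [toEuclideanLin_of_apply]
    simp [mul_comm]
  have h2 : ∀ c : Fin n → ℝ, ‖(WithLp.toLp 2 c : EuclideanSpace ℝ (Fin n))‖ = Real.sqrt (sqn c) := by
    intro c
    rw [EuclideanSpace.norm_eq]
    simp [sqn]
  rw [h1, ← h2, ← h2]
  calc _ ≤ _ := abs_real_inner_le_norm _ _
    _ ≤ ‖(WithLp.toLp 2 a : EuclideanSpace ℝ (Fin n))‖ *
        (‖T‖ * ‖(WithLp.toLp 2 b : EuclideanSpace ℝ (Fin n))‖) := by
      gcongr; exact T.le_opNorm _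
    _ = _ := by rw [opNorm]; ring

theorem opNorm_le_of_bilin {n : ℕ} (G : Fin n → Fin n → ℝ) {Θ : ℝ} (hΘ : 0 ≤ Θ)
    (h : ∀ a b, qform G a b ≤ Θ * Real.sqrt (sqn a) * Real.sqrt (sqn b)) :
    opNorm (Matrix.of G) ≤ Θ := by
  refine ContinuousLinearMap.opNorm_le_bound _ hΘ fun x => ?_
  change ‖Matrix.toEuclideanLin (Matrix.of G) x‖ ≤ _
  set y := Matrix.toEuclideanLin (Matrix.of G) x with hy
  have h1 : qform G (fun i => y i) (fun i => x i) = ‖y‖ ^ 2 := by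
    rw [qform_eq_sum_mul, EuclideanSpace.real_norm_sq_eq]
    refine Finset.sum_congr rfl fun i _ => ?_
    rw [hy, toEuclideanLin_of_apply, sq]
  have h2 : ∀ c : EuclideanSpace ℝ (Fin n), Real.sqrt (sqn fun i => c i) = ‖c‖ := by
    intro c
    rw [EuclideanSpace.norm_eq]
    simp [sqn]
  have h3 := h (fun i => y i) (fun i => x i)
  rw [h1, h2, h2] at h3
  rcases (norm_nonneg y).eq_or_lt with h0 | h0
  · rw [← h0]; positivity
  · nlinarith

theorem IsCorr.opNorm_le {n : ℕ} {G : Fin n → Fin n → ℝ} (hG : IsCorr G) {Θ : ℝ} (hΘ : 0 ≤ Θ)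
    (h : ∀ a, qform G a a ≤ Θ * sqn a) : opNorm (Matrix.of G) ≤ Θ := by
  refine opNorm_le_of_bilin G hΘ fun a b => ?_
  refine (le_abs_self _).trans (abs_le_of_sq_le_sq ?_ (by positivity))
  calc _ ≤ qform G a a * qform G b b := hG.cauchy_schwarz a b
    _ ≤ (Θ * sqn a) * (Θ * sqn b) :=
      mul_le_mul (h a) (h b) (hG.psd b) (mul_nonneg hΘ (sqn_nonneg a))
    _ = _ := by
      rw [mul_pow, mul_pow, Real.sq_sqrt (sqn_nonneg a), Real.sq_sqrt (sqn_nonneg b)]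
      ring

theorem sq_sum_abs_le {n : ℕ} (a : Fin n → ℝ) : (∑ i, |a i|) ^ 2 ≤ n * sqn a := by
  have := sq_sum_le_card_mul_sum_sq (s := Finset.univ) (f := fun i => |a i|)
  simpa [sqn] using this

theorem opNorm_le_of_entries {n : ℕ} {G : Fin n → Fin n → ℝ} {c : ℝ} (hc : 0 ≤ c)
    (h : ∀ i j, |G i j| ≤ c) : opNorm (Matrix.of G) ≤ c * n := by
  refine opNorm_le_of_bilin G (by positivity) fun a b => ?_
  have h1 : qform G a b ≤ c * ((∑ i, |a i|) * ∑ j, |b j|) := by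
    rw [Finset.sum_mul_sum, Finset.mul_sum]
    refine Finset.sum_le_sum fun i _ => ?_
    rw [Finset.mul_sum]
    refine Finset.sum_le_sum fun j _ => (le_abs_self _).trans ?_
    rw [abs_mul, abs_mul, mul_comm c]
    gcongr
    exact h i j
  have h2 : ∀ a : Fin n → ℝ, ∑ i, |a i| ≤ Real.sqrt n * Real.sqrt (sqn a) := by
    intro a
    rw [← Real.sqrt_mul (by positivity)]
    exact Real.le_sqrt_of_sq_le (sq_sum_abs_le a)
  calc _ ≤ _ := h1
    _ ≤ c * ((Real.sqrt n * Real.sqrt (sqn a)) * (Real.sqrt n * Real.sqrt (sqn b))) := by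
      gcongr <;> exact h2 _
    _ = c * (Real.sqrt n * Real.sqrt n) * Real.sqrt (sqn a) * Real.sqrt (sqn b) := by ring
    _ = _ := by rw [Real.mul_self_sqrt (by positivity)]

theorem IsCorr.opNorm_le_card {n : ℕ} {G : Fin n → Fin n → ℝ} (hG : IsCorr G) :
    opNorm (Matrix.of G) ≤ n := by
  simpa using opNorm_le_of_entries zero_le_one hG.abs_le

theorem IsCorr.opNorm_le_two {n : ℕ} {G : Fin n → Fin n → ℝ} (hG : IsCorr G)
    (h : ∀ i j, i ≠ j → |G i j| ≤ 1 / n) : opNorm (Matrix.of G) ≤ 2 := by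
  refine hG.opNorm_le zero_le_two fun a => ?_
  have h1 : qform G a a ≤ sqn a + (1 / n) * (∑ i, |a i|) ^ 2 := by
    rw [sq, Finset.sum_mul_sum, Finset.mul_sum, sqn, ← Finset.sum_add_distrib]
    refine Finset.sum_le_sum fun i _ => ?_
    rw [Finset.mul_sum, ← Finset.add_sum_erase _ _ (Finset.mem_univ i), hG.diag i, mul_one, sq]
    refine add_le_add le_rfl ?_
    refine (Finset.sum_le_sum fun j hj => ?_).trans (Finset.sum_le_sum_of_subset_of_nonneg
      (Finset.erase_subset i Finset.univ) fun _ _ _ => by positivity)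
    refine (le_abs_self _).trans ?_
    rw [abs_mul, abs_mul, mul_comm (1 / (n : ℝ))]
    gcongr
    exact h i j (Finset.ne_of_mem_erase hj).symm
  refine h1.trans ?_
  rcases Nat.eq_zero_or_pos n with hn | hn
  · subst hn; simp [sqn]
  · have hn' : (0 : ℝ) < n := by exact_mod_cast hn
    have := mul_le_mul_of_nonneg_left (sq_sum_abs_le a) (one_div_pos.2 hn').le
    rw [← mul_assoc, one_div_mul_cancel hn'.ne', one_mul] at this
    linarith

theorem isCorr_zker {d k n : ℕ} (hd : 2 ≤ d) {σ : Measure (EuclideanSpace ℝ (Fin d))}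
    (hσ : IsSphereLaw σ) {w : Fin n → EuclideanSpace ℝ (Fin d)} (hw : ∀ i, ‖w i‖ = 1) :
    IsCorr fun i j => zker k (w i) (w j) where
  symm _ _ := zker_comm _ _
  diag i := zker_self hd (hw i)
  abs_le i j := abs_zker_le_one hd hσ (hw i) (hw j)
  psd := gramForm_nonneg hd hσ hw

theorem QWmat_eq {d k n : ℕ} (hd : 2 ≤ d) {q : Polynomial ℝ} (hq : IsGegenbauer d k q)
    (w : Fin n → EuclideanSpace ℝ (Fin d)) :
    QWmat d n q (sphDim d k) w = Matrix.of fun i j => zker k (w i) (w j) := by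
  have hN : Real.sqrt (sphDim d k) ≠ 0 :=
    (Real.sqrt_pos.2 (by exact_mod_cast sphDim_pos hd k)).ne'
  ext i j
  rw [QWmat, Matrix.of_apply, hq.eval_eq hd, mul_div_cancel_left₀ _ hN]
  rfl

/-- The support of a vector of coordinates. -/
def vsupp {n : ℕ} (a : Fin n → ℝ) : Finset (Fin n) := Finset.univ.filter fun i => a i ≠ 0

theorem mem_vsupp {n : ℕ} {a : Fin n → ℝ} {i : Fin n} : i ∈ vsupp a ↔ a i ≠ 0 := by
  simp [vsupp]

theorem sqn_restrict_le {n : ℕ} (S : Finset (Fin n)) (a : Fin n → ℝ) :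
    sqn (fun i => if i ∈ S then a i else 0) ≤ sqn a := by
  refine Finset.sum_le_sum fun i _ => ?_
  dsimp only
  split_ifs
  · exact le_rfl
  · rw [zero_pow two_ne_zero]; positivity

theorem vsupp_restrict_subset {n : ℕ} (S : Finset (Fin n)) (a : Fin n → ℝ) :
    vsupp (fun i => if i ∈ S then a i else 0) ⊆ S := by
  intro i hi
  rw [mem_vsupp] at hi
  by_contra h
  simp [h] at hi

theorem vsupp_restrict_subset' {n : ℕ} (S : Finset (Fin n)) (a : Fin n → ℝ) :
    vsupp (fun i => if i ∈ S then a i else 0) ⊆ vsupp a := by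
  intro i hi
  rw [mem_vsupp] at hi ⊢
  intro h
  simp [h] at hi

theorem sum_abs_le_of_vsupp {n m : ℕ} {a : Fin n → ℝ} {T : Finset (Fin n)} (hT : T.card ≤ m)
    (h1 : sqn a ≤ 1) : ∑ i ∈ T, |a i| ≤ Real.sqrt m := by
  refine Real.le_sqrt_of_sq_le ?_
  have h := sq_sum_le_card_mul_sum_sq (s := T) (f := fun i => |a i|)
  simp only [sq_abs] at h
  have h2 : ∑ i ∈ T, a i ^ 2 ≤ 1 := (Finset.sum_le_sum_of_subset_of_nonneg
    (Finset.subset_univ _) fun _ _ _ => sq_nonneg _).trans h1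
  calc _ ≤ _ := h
    _ ≤ (m : ℝ) * 1 := by gcongr
    _ = m := mul_one _

/-- The form is bounded by `β` on pairs of disjointly supported sparse unit vectors. -/
def SparseBound {n : ℕ} (G : Fin n → Fin n → ℝ) (s t : ℕ) (β : ℝ) : Prop :=
  ∀ a b : Fin n → ℝ, (vsupp a).card ≤ s → (vsupp b).card ≤ t → Disjoint (vsupp a) (vsupp b) →
    sqn a ≤ 1 → sqn b ≤ 1 → qform G a b ≤ β

theorem SparseBound.symm {n : ℕ} {G : Fin n → Fin n → ℝ} (hG : IsCorr G) {s t : ℕ} {β : ℝ}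
    (h : SparseBound G s t β) : SparseBound G t s β := fun a b ha hb hab h1 h2 => by
  rw [hG.qform_comm]; exact h b a hb ha hab.symm h2 h1

theorem IsCorr.sparseBound_one {n : ℕ} {G : Fin n → Fin n → ℝ} (hG : IsCorr G) :
    SparseBound G 1 1 1 := by
  intro a b ha hb _ h1 h2
  have hs : ∀ a : Fin n → ℝ, ∑ i, |a i| = ∑ i ∈ vsupp a, |a i| := fun a =>
    (Finset.sum_subset (Finset.subset_univ _) fun i _ hi => by
      rw [mem_vsupp, not_not] at hi; simp [hi]).symm
  have ha' := sum_abs_le_of_vsupp ha h1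
  have hb' := sum_abs_le_of_vsupp hb h2
  rw [← hs, Nat.cast_one, Real.sqrt_one] at ha' hb'
  calc qform G a b ≤ (∑ i, |a i|) * ∑ j, |b j| := by
        rw [Finset.sum_mul_sum]
        refine Finset.sum_le_sum fun i _ => Finset.sum_le_sum fun j _ => ?_
        refine (le_abs_self _).trans ?_
        rw [abs_mul, abs_mul]
        exact mul_le_of_le_one_right (by positivity) (hG.abs_le i j)
    _ ≤ 1 * 1 := by gcongr
    _ = 1 := one_mul 1

/-- One doubling step of the right sparsity level. -/
theorem SparseBound.double_right {n : ℕ} {G : Fin n → Fin n → ℝ} (hG : IsCorr G) {s h : ℕ}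
    {β s2 η : ℝ} (hs2 : 0 ≤ s2) (hη : 0 ≤ η) (hs : s ≤ 2 * h) (Net : Set (Fin n → ℝ))
    (hnet : ∀ a : Fin n → ℝ, (vsupp a).card ≤ 2 * h → sqn a ≤ 1 →
      ∃ a' ∈ Net, vsupp a' ⊆ vsupp a ∧ sqn a' ≤ 1 ∧ sqn (a - a') ≤ η ^ 2)
    (hgood : ∀ a' ∈ Net, (Finset.univ.filter fun i =>
      a' i = 0 ∧ s2 * qform G a' a' < (∑ l, G i l * a' l) ^ 2).card < h)
    (hβ : SparseBound G s h β) :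
    SparseBound G s (2 * h) (β + (Real.sqrt ((2 * h : ℕ) * s2) * Real.sqrt (opNorm (Matrix.of G))
      + η * opNorm (Matrix.of G))) := by
  intro a b ha hb hab h1 h2
  set Θ := opNorm (Matrix.of G)
  have hΘ : 0 ≤ Θ := opNorm_of_nonneg _
  obtain ⟨a', haN, hsub, h1', hη'⟩ := hnet a (ha.trans hs) h1
  set E := Finset.univ.filter fun i =>
    a' i = 0 ∧ s2 * qform G a' a' < (∑ l, G i l * a' l) ^ 2 with hE
  have hab' : Disjoint (vsupp a') (vsupp b) := Finset.disjoint_of_subset_left hsub hab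
  have e0 : qform G a b = qform G (a - a') b + qform G a' b := by
    rw [← qform_add_left, sub_add_cancel]
  have e1 : qform G (a - a') b ≤ η * Θ := by
    refine (le_abs_self _).trans ((abs_qform_le G _ _).trans ?_)
    have h3 : Real.sqrt (sqn (a - a')) ≤ η := by
      rw [← Real.sqrt_sq hη]; exact Real.sqrt_le_sqrt hη'
    have h4 : Real.sqrt (sqn b) ≤ 1 := Real.sqrt_le_one.2 h2
    calc _ ≤ Θ * η * 1 := by gcongr
      _ = _ := by ring
  set b₁ : Fin n → ℝ := fun i => if i ∈ E then b i else 0 with hb₁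
  set b₂ : Fin n → ℝ := fun i => if i ∈ Eᶜ then b i else 0 with hb₂
  have e2 : b = b₁ + b₂ := by
    funext i
    by_cases hi : i ∈ E <;> simp [hb₁, hb₂, hi]
  have e3 : qform G a' b₁ ≤ β := by
    refine hβ a' b₁ ((Finset.card_le_card hsub).trans ha) ?_ ?_ h1' ((sqn_restrict_le _ _).trans h2)
    · exact (Finset.card_le_card (vsupp_restrict_subset _ _)).trans (hgood a' haN).le
    · exact Finset.disjoint_of_subset_right (vsupp_restrict_subset' _ _) hab'
  have hqa : qform G a' a' ≤ Θ := by
    refine (le_abs_self _).trans ((abs_qform_le G _ _).trans ?_)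
    have h4 : Real.sqrt (sqn a') ≤ 1 := Real.sqrt_le_one.2 h1'
    calc _ ≤ Θ * 1 * 1 := by gcongr
      _ = Θ := by ring
  have e4 : qform G a' b₂ ≤ Real.sqrt ((2 * h : ℕ) * s2) * Real.sqrt Θ := by
    rw [hG.qform_comm, qform_eq_sum_mul]
    have h5 : ∀ i, b₂ i * ∑ l, G i l * a' l
        ≤ (if i ∈ vsupp b then |b i| else 0) * Real.sqrt (s2 * Θ) := by
      intro i
      by_cases hi : i ∈ vsupp b
      · by_cases hiE : i ∈ E
        · simp only [hb₂, Finset.mem_compl, hiE, not_true_eq_false, if_false, zero_mul]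
          positivity
        · have hai : a' i = 0 := by
            by_contra h
            exact Finset.disjoint_left.1 hab' (mem_vsupp.2 h) hi
          have h6 : (∑ l, G i l * a' l) ^ 2 ≤ s2 * qform G a' a' := by
            by_contra h
            exact hiE (by rw [hE, Finset.mem_filter]; exact ⟨Finset.mem_univ _, hai, not_le.1 h⟩)
          simp only [hb₂, Finset.mem_compl, hiE, not_false_eq_true, if_true, hi]
          refine (le_abs_self _).trans ?_
          rw [abs_mul]
          refine mul_le_mul_of_nonneg_left ?_ (abs_nonneg _)
          exact Real.abs_le_sqrt (h6.trans (mul_le_mul_of_nonneg_left hqa hs2))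
      · have : b i = 0 := by rwa [mem_vsupp, not_not] at hi
        simp [hb₂, this, hi]
    refine (Finset.sum_le_sum fun i _ => h5 i).trans ?_
    rw [← Finset.sum_mul, ← Finset.sum_filter, Finset.filter_mem_eq_inter, Finset.univ_inter]
    calc _ ≤ Real.sqrt (2 * h : ℕ) * Real.sqrt (s2 * Θ) := by
          gcongr; exact sum_abs_le_of_vsupp hb h2
      _ = _ := by
        rw [Real.sqrt_mul hs2, Real.sqrt_mul (by positivity)]; ring
  rw [e0, e2, qform_add_right G a', ← e2]
  linarith

/-- Decoupling: the diagonal form is controlled by the form on disjointly supported vectors. -/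
theorem IsCorr.qform_self_le {n : ℕ} {G : Fin n → Fin n → ℝ} (hG : IsCorr G) {β : ℝ}
    (hβ : SparseBound G n n β) {a : Fin n → ℝ} (ha : sqn a ≤ 1) :
    qform G a a ≤ 1 + 4 * β := by
  have hcount : ∀ i j : Fin n, i ≠ j → ((Finset.univ.filter fun I : Finset (Fin n) =>
      i ∈ I ∧ j ∉ I).card : ℝ) = 2 ^ n / 4 := by
    intro i j hij
    have h1 : (Finset.univ.filter fun I : Finset (Fin n) => i ∈ I ∧ j ∉ I)
        = Finset.Icc {i} {j}ᶜ := by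
      ext I
      rw [Finset.mem_filter, Finset.mem_Icc, Finset.singleton_subset_iff, Finset.subset_compl_comm, Finset.singleton_subset_iff,
        Finset.mem_compl]
      simp
    have hn : 2 ≤ n := by
      have h1 := i.2
      have h2 := j.2
      have h3 : (i : ℕ) ≠ j := fun h => hij (Fin.ext h)
      omega
    obtain ⟨m, rfl⟩ : ∃ m, n = m + 2 := ⟨n - 2, by omega⟩
    rw [h1, Finset.card_Icc_finset (by simpa using hij.symm), Finset.card_compl, Finset.card_singleton,
      Finset.card_singleton, Fintype.card_fin, show m + 2 - 1 - 1 = m by omega]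
    push_cast
    ring
  have hI : ∀ I : Finset (Fin n), qform G (fun i => if i ∈ I then a i else 0)
      (fun i => if i ∈ Iᶜ then a i else 0) ≤ β := by
    intro I
    refine hβ _ _ (by simpa using Finset.card_le_univ (vsupp _))
      (by simpa using Finset.card_le_univ (vsupp _)) ?_
      ((sqn_restrict_le _ _).trans ha) ((sqn_restrict_le _ _).trans ha)
    exact Finset.disjoint_of_subset_left (vsupp_restrict_subset _ _)
      (Finset.disjoint_of_subset_right (vsupp_restrict_subset _ _) disjoint_compl_right)
  have hsum : ∑ I : Finset (Fin n), qform G (fun i => if i ∈ I then a i else 0)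
      (fun i => if i ∈ Iᶜ then a i else 0)
      = 2 ^ n / 4 * (qform G a a - sqn a) := by
    have h1 : qform G a a - sqn a = ∑ i, ∑ j, (if i = j then 0 else a i * a j * G i j) := by
      rw [qform, sqn, ← Finset.sum_sub_distrib]
      refine Finset.sum_congr rfl fun i _ => ?_
      have : ∀ j, (if i = j then 0 else a i * a j * G i j)
          = a i * a j * G i j - (if i = j then a i * a j * G i j else 0) := by
        intro j; split_ifs <;> ring
      simp only [this, Finset.sum_sub_distrib, Finset.sum_ite_eq, Finset.mem_univ, if_true,
        hG.diag]
      ring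
    rw [h1, Finset.mul_sum]
    simp only [qform]
    rw [Finset.sum_comm]
    refine Finset.sum_congr rfl fun i _ => ?_
    rw [Finset.sum_comm, Finset.mul_sum]
    refine Finset.sum_congr rfl fun j _ => ?_
    have h2 : ∀ I : Finset (Fin n), (if i ∈ I then a i else 0) * (if j ∈ Iᶜ then a j else 0) * G i j
        = if i ∈ I ∧ j ∉ I then a i * a j * G i j else 0 := by
      intro I
      by_cases hi : i ∈ I <;> by_cases hj : j ∈ I <;> simp [hi, hj]
    simp only [h2]
    rw [← Finset.sum_filter, Finset.sum_const, nsmul_eq_mul]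
    split_ifs with hij
    · subst hij; simp
    · rw [hcount i j hij]
  have hle := Finset.sum_le_sum fun I (_ : I ∈ (Finset.univ : Finset (Finset (Fin n)))) => hI I
  rw [hsum, Finset.sum_const, Finset.card_univ, Fintype.card_finset, Fintype.card_fin,
    nsmul_eq_mul] at hle
  push_cast at hle
  have h2n : (0 : ℝ) < 2 ^ n := by positivity
  have : (2 : ℝ) ^ n * (qform G a a - sqn a) ≤ 2 ^ n * (4 * β) := by linarith
  have := le_of_mul_le_mul_left this h2n
  linarith

/-- Deterministic chaining over dyadic sparsity levels. -/
theorem IsCorr.opNorm_le_of_chaining {n J : ℕ} (hn : n ≤ 2 ^ J) {G : Fin n → Fin n → ℝ}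
    (hG : IsCorr G) {s2 η : ℕ → ℝ} (hs2 : ∀ i, 0 ≤ s2 i) (hη : ∀ i, 0 ≤ η i)
    (Net : ℕ → Set (Fin n → ℝ))
    (hnet : ∀ i < J, ∀ a : Fin n → ℝ, (vsupp a).card ≤ 2 * 2 ^ i → sqn a ≤ 1 →
      ∃ a' ∈ Net i, vsupp a' ⊆ vsupp a ∧ sqn a' ≤ 1 ∧ sqn (a - a') ≤ η i ^ 2)
    (hgood : ∀ i < J, ∀ a' ∈ Net i, (Finset.univ.filter fun l =>
      a' l = 0 ∧ s2 i * qform G a' a' < (∑ j, G l j * a' j) ^ 2).card < 2 ^ i)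
    {E : ℝ} (hE : ∑ i ∈ Finset.range J, Real.sqrt ((2 * 2 ^ i : ℕ) * s2 i) ≤ E)
    (hsum : ∑ i ∈ Finset.range J, η i ≤ 1 / 16) :
    opNorm (Matrix.of G) ≤ 20 + 256 * E ^ 2 := by
  set Θ := opNorm (Matrix.of G) with hΘd
  have hΘ : 0 ≤ Θ := opNorm_of_nonneg _
  have hstep : ∀ l ≤ J, SparseBound G (2 ^ l) (2 ^ l)
      (1 + 2 * ∑ i ∈ Finset.range l,
        (Real.sqrt ((2 * 2 ^ i : ℕ) * s2 i) * Real.sqrt Θ + η i * Θ)) := by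
    intro l
    induction l with
    | zero => intro _; simpa using hG.sparseBound_one
    | succ l ih =>
      intro hl
      have h1 := SparseBound.double_right hG (hs2 l) (hη l) (by omega) (Net l)
        (hnet l (by omega)) (hgood l (by omega)) (ih (by omega))
      have h2 := SparseBound.double_right hG (hs2 l) (hη l) le_rfl (Net l)
        (hnet l (by omega)) (hgood l (by omega)) (h1.symm hG)
      rw [Finset.sum_range_succ, pow_succ, mul_comm _ 2]
      convert h2 using 1
      ring
  have hβ := hstep J le_rfl
  rw [Finset.sum_add_distrib, ← Finset.sum_mul, ← Finset.sum_mul] at hβ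
  have hsqrt := Real.sqrt_nonneg Θ
  have hnn : SparseBound G n n (1 + 2 * (E * Real.sqrt Θ + 1 / 16 * Θ)) := by
    intro a b ha hb hab h1 h2
    refine (hβ a b (ha.trans hn) (hb.trans hn) hab h1 h2).trans ?_
    gcongr
  have hE0 : 0 ≤ E := (Finset.sum_nonneg fun _ _ => Real.sqrt_nonneg _).trans hE
  have hfin : Θ ≤ 1 + 4 * (1 + 2 * (E * Real.sqrt Θ + 1 / 16 * Θ)) := by
    refine hG.opNorm_le (by positivity) fun a => ?_
    rcases (sqn_nonneg a).eq_or_lt with h0 | h0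
    · have : qform G a a ≤ _ := (le_abs_self _).trans (abs_qform_le G a a)
      rw [← h0, Real.sqrt_zero, mul_zero] at this
      rw [← h0, mul_zero]; exact this
    · set c := Real.sqrt (sqn a)
      have hc : 0 < c := Real.sqrt_pos.2 h0
      have hc2 : c ^ 2 = sqn a := Real.sq_sqrt h0.le
      have h1 := hG.qform_self_le hnn (a := c⁻¹ • a) (by
        simp only [sqn, Pi.smul_apply, smul_eq_mul, mul_pow, ← Finset.mul_sum]
        change c⁻¹ ^ 2 * sqn a ≤ 1
        rw [← hc2]
        field_simp
        exact le_rfl)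
      rw [qform_smul_left, qform_smul_right] at h1
      rw [← hc2]
      have h3 := mul_le_mul_of_nonneg_right h1 (sq_nonneg c)
      field_simp at h3 ⊢
      linarith
  have hsq : Real.sqrt Θ ^ 2 = Θ := Real.sq_sqrt hΘ
  nlinarith [sq_nonneg (Real.sqrt Θ - 16 * E)]

/-- Integer vectors with at most `m` nonzero coordinates and `ℓ¹` norm at most `Q`. -/
def sparseInt (n m Q : ℕ) : Finset (Fin n → ℤ) :=
  (Fintype.piFinset fun _ : Fin n => Finset.Icc (-(Q : ℤ)) Q).filter fun z =>
    (Finset.univ.filter fun i => z i ≠ 0).card ≤ m ∧ ∑ i, (z i).natAbs ≤ Q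

theorem mem_sparseInt {n m Q : ℕ} {z : Fin n → ℤ} : z ∈ sparseInt n m Q ↔
    (Finset.univ.filter fun i => z i ≠ 0).card ≤ m ∧ ∑ i, (z i).natAbs ≤ Q := by
  rw [sparseInt, Finset.mem_filter, and_iff_right_iff_imp]
  rintro ⟨-, h⟩
  rw [Fintype.mem_piFinset]
  intro i
  have := (Finset.single_le_sum (f := fun i => (z i).natAbs) (fun _ _ => Nat.zero_le _)
    (Finset.mem_univ i)).trans h
  rw [Finset.mem_Icc]
  omega

theorem sum_inv_pow_le {μ : ℝ} (hμ : 1 < μ) (Q : ℕ) :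
    ∑ t ∈ Finset.range Q, μ⁻¹ ^ (t + 1) ≤ 1 / (μ - 1) := by
  have h : (μ - 1) * ∑ t ∈ Finset.range Q, μ⁻¹ ^ (t + 1) = 1 - μ⁻¹ ^ Q := by
    induction Q with
    | zero => simp
    | succ Q ih =>
      rw [Finset.sum_range_succ, mul_add, ih, pow_succ]
      have : μ ≠ 0 := by linarith
      field_simp
      ring
  rw [le_div_iff₀ (by linarith), mul_comm, h]
  have : 0 < μ⁻¹ ^ Q := pow_pos (inv_pos.2 (by linarith)) Q
  linarith

theorem card_sparseInt_le_weight (n m Q : ℕ) {lam μ : ℝ} (hl : 1 ≤ lam) (hμ : 1 < μ) :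
    ((sparseInt n m Q).card : ℝ) ≤ lam ^ m * μ ^ Q * (1 + 2 / (lam * (μ - 1))) ^ n := by
  have hl0 : 0 < lam := by linarith
  have hμ0 : 0 < μ := by linarith
  set w : ℤ → ℝ := fun t => (if t = 0 then 1 else lam⁻¹) * μ⁻¹ ^ t.natAbs with hw
  have hw0 : ∀ t, 0 ≤ w t := fun t => by
    simp only [hw]
    split_ifs <;> positivity
  have hsum : ∑ t ∈ Finset.Icc (-(Q : ℤ)) Q, w t ≤ 1 + 2 / (lam * (μ - 1)) := by
    have heven : ∀ t, w (-t) = w t := fun t => by simp [hw]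
    rw [Finset.sum_Icc_of_even_eq_range (f := w) heven Q, Finset.sum_range_succ']
    have h1 : ∀ t : ℕ, w ((t + 1 : ℕ) : ℤ) = lam⁻¹ * μ⁻¹ ^ (t + 1) := fun t => by
      have : ((t : ℤ) + 1) ≠ 0 := by omega
      simp only [hw, Nat.cast_add, Nat.cast_one, if_neg this]
      rfl
    have h2 : w 0 = 1 := by simp [hw]
    simp only [h1, Nat.cast_zero, h2, ← Finset.mul_sum]
    have h3 := sum_inv_pow_le hμ Q
    have h4 : lam⁻¹ * ∑ t ∈ Finset.range Q, μ⁻¹ ^ (t + 1) ≤ lam⁻¹ * (1 / (μ - 1)) := by gcongr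
    have h5 : 2 / (lam * (μ - 1)) = 2 * (lam⁻¹ * (1 / (μ - 1))) := by
      field_simp
    rw [h5, two_nsmul]
    linarith
  have hterm : ∀ z ∈ sparseInt n m Q, (1 : ℝ) ≤ lam ^ m * μ ^ Q * ∏ i, w (z i) := by
    intro z hz
    obtain ⟨hz1, hz2⟩ := mem_sparseInt.1 hz
    simp only [hw, Finset.prod_mul_distrib, Finset.prod_pow_eq_pow_sum]
    have e1 : ∏ i, (if z i = 0 then (1 : ℝ) else lam⁻¹)
        = lam⁻¹ ^ (Finset.univ.filter fun i => z i ≠ 0).card := by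
      rw [Finset.prod_ite, Finset.prod_const_one, one_mul, Finset.prod_const]
    rw [e1, inv_pow, inv_pow]
    have h1 := pow_le_pow_right₀ hl hz1
    have h2 := pow_le_pow_right₀ hμ.le hz2
    have h3 : (0 : ℝ) < lam ^ (Finset.univ.filter fun i => z i ≠ 0).card := by positivity
    have h4 : (0 : ℝ) < μ ^ ∑ i, (z i).natAbs := by positivity
    rw [mul_mul_mul_comm, ← div_eq_mul_inv, ← div_eq_mul_inv]
    exact one_le_mul_of_one_le_of_one_le ((one_le_div h3).2 h1) ((one_le_div h4).2 h2)
  calc ((sparseInt n m Q).card : ℝ) = ∑ z ∈ sparseInt n m Q, (1 : ℝ) := by simp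
    _ ≤ ∑ z ∈ sparseInt n m Q, lam ^ m * μ ^ Q * ∏ i, w (z i) := Finset.sum_le_sum hterm
    _ ≤ ∑ z ∈ Fintype.piFinset fun _ : Fin n => Finset.Icc (-(Q : ℤ)) Q,
          lam ^ m * μ ^ Q * ∏ i, w (z i) :=
        Finset.sum_le_sum_of_subset_of_nonneg (Finset.filter_subset _ _) fun z _ _ =>
          mul_nonneg (by positivity) (Finset.prod_nonneg fun i _ => hw0 _)
    _ = lam ^ m * μ ^ Q * (∑ t ∈ Finset.Icc (-(Q : ℤ)) Q, w t) ^ n := by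
        rw [← Finset.mul_sum, ← Finset.prod_univ_sum, Finset.prod_const, Finset.card_univ,
          Fintype.card_fin]
    _ ≤ _ := by
        have : 0 ≤ ∑ t ∈ Finset.Icc (-(Q : ℤ)) Q, w t := Finset.sum_nonneg fun _ _ => hw0 _
        gcongr

theorem one_add_inv_pow_le {x : ℝ} (hx : 0 < x) {a b : ℕ} (h : (a : ℝ) ≤ b * x) :
    (1 + 1 / x) ^ a ≤ Real.exp 1 ^ b := by
  calc (1 + 1 / x) ^ a ≤ Real.exp (1 / x) ^ a := by
        gcongr
        linarith [Real.add_one_le_exp (1 / x)]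
    _ = Real.exp (a * (1 / x)) := by rw [← Real.exp_nat_mul]
    _ ≤ Real.exp (b * 1) := by
        refine Real.exp_le_exp.2 ?_
        rw [mul_one_div, div_le_iff₀ hx]
        simpa using h
    _ = _ := by rw [Real.exp_nat_mul]

theorem card_sparseInt_le {n m y : ℕ} (hy : 1 ≤ y) (hn : n ≤ m * y) :
    ((sparseInt n m (32 * m * y)).card : ℝ) ≤ (2 ^ 10 * (y : ℝ) ^ 2) ^ m := by
  have hy' : (1 : ℝ) ≤ y := by exact_mod_cast hy
  have hμ : (1 : ℝ) < 1 + 1 / (32 * y) := by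
    have : (0 : ℝ) < 1 / (32 * y) := by positivity
    linarith
  have h := card_sparseInt_le_weight n m (32 * m * y) (lam := 64 * (y : ℝ) ^ 2)
    (by nlinarith) hμ
  refine h.trans ?_
  have e1 : 1 + 2 / (64 * (y : ℝ) ^ 2 * (1 + 1 / (32 * y) - 1)) = 1 + 1 / (y : ℝ) := by
    field_simp
    ring
  rw [e1]
  have h1 : (1 + 1 / (32 * y : ℝ)) ^ (32 * m * y) ≤ Real.exp 1 ^ m :=
    one_add_inv_pow_le (by positivity) (by push_cast; linarith)
  have h2 : (1 + 1 / (y : ℝ)) ^ n ≤ Real.exp 1 ^ m :=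
    one_add_inv_pow_le (by positivity) (by exact_mod_cast hn)
  have he : Real.exp 1 ≤ 4 := by linarith [Real.exp_one_lt_d9]
  calc _ ≤ (64 * (y : ℝ) ^ 2) ^ m * 4 ^ m * 4 ^ m := by
        have he0 : 0 < Real.exp 1 := Real.exp_pos 1
        have h3 : Real.exp 1 ^ m ≤ 4 ^ m := by gcongr
        gcongr
        · exact h1.trans h3
        · exact h2.trans h3
    _ = _ := by
        rw [← mul_pow, ← mul_pow]
        ring_nf

theorem choose_le_pow {n h y : ℕ} (hy : 1 ≤ y) (hn : n ≤ 2 * h * y) :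
    (n.choose h : ℝ) ≤ (8 * (y : ℝ)) ^ h := by
  have hy' : (1 : ℝ) ≤ y := by exact_mod_cast hy
  have h1 : (n.choose h : ℝ) * (1 / (2 * y : ℝ)) ^ h ≤ (1 + 1 / (2 * y : ℝ)) ^ n := by
    rcases le_or_gt h n with hh | hh
    · rw [add_comm, add_pow]
      refine le_trans (le_of_eq ?_) (Finset.single_le_sum (f := fun t =>
        (1 / (2 * y : ℝ)) ^ t * 1 ^ (n - t) * (n.choose t : ℝ)) (fun t _ => by positivity)
        (Finset.mem_range.2 (Nat.lt_succ_of_le hh)))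
      rw [one_pow, mul_one, mul_comm]
    · rw [Nat.choose_eq_zero_of_lt hh]
      simp only [Nat.cast_zero, zero_mul]
      positivity
  have h2 : (1 + 1 / (2 * y : ℝ)) ^ n ≤ Real.exp 1 ^ h :=
    one_add_inv_pow_le (by positivity) (by
      have : (n : ℝ) ≤ 2 * h * y := by exact_mod_cast hn
      linarith)
  have he : Real.exp 1 ≤ 4 := by linarith [Real.exp_one_lt_d9]
  have he0 : 0 < Real.exp 1 := Real.exp_pos 1
  have h3 : Real.exp 1 ^ h ≤ 4 ^ h := by gcongr
  rw [one_div_pow, mul_one_div, div_le_iff₀ (by positivity)] at h1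
  calc (n.choose h : ℝ) ≤ _ := h1
    _ ≤ 4 ^ h * (2 * y : ℝ) ^ h := by gcongr; exact h2.trans h3
    _ = _ := by rw [← mul_pow]; ring_nf

/-- Rounding the coordinates of a sparse vector towards zero. -/
theorem exists_sparseInt_near {n m y : ℕ} (hm : 1 ≤ m) (hy : 1 ≤ y) {a : Fin n → ℝ}
    (ha : (vsupp a).card ≤ m) (h1 : sqn a ≤ 1) :
    ∃ z ∈ sparseInt n m (32 * m * y), ∃ a' : Fin n → ℝ,
      a' = (fun i => 1 / (32 * y * Real.sqrt m) * (z i : ℝ)) ∧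
      vsupp a' ⊆ vsupp a ∧ sqn a' ≤ 1 ∧ sqn (a - a') ≤ (1 / (32 * (y : ℝ))) ^ 2 := by
  have hm' : (0 : ℝ) < m := by exact_mod_cast hm
  have hy' : (0 : ℝ) < y := by exact_mod_cast hy
  have hsm := Real.sqrt_pos.2 hm'
  have hsm2 := Real.sq_sqrt hm'.le
  set δ : ℝ := 1 / (32 * y * Real.sqrt m) with hδ
  have hδ0 : 0 < δ := by positivity
  have key : ∀ t : ℝ, ∃ z : ℤ, (t = 0 → z = 0) ∧ |δ * z| ≤ |t| ∧ |t - δ * z| ≤ δ := by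
    intro t
    have hpos : ∀ t : ℝ, 0 ≤ t → ∃ z : ℤ, (t = 0 → z = 0) ∧ |δ * z| ≤ |t| ∧ |t - δ * z| ≤ δ := by
      intro t ht
      have f1 := Int.floor_le (t / δ)
      have f2 := Int.lt_floor_add_one (t / δ)
      have f3 : (0 : ℝ) ≤ ⌊t / δ⌋ := by
        exact_mod_cast Int.floor_nonneg.2 (div_nonneg ht hδ0.le)
      rw [le_div_iff₀ hδ0] at f1
      rw [div_lt_iff₀ hδ0] at f2
      refine ⟨⌊t / δ⌋, fun h => by simp [h], ?_, ?_⟩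
      · rw [abs_of_nonneg (by positivity), abs_of_nonneg ht]; linarith
      · rw [abs_le]; constructor <;> linarith
    rcases le_total 0 t with ht | ht
    · exact hpos t ht
    · obtain ⟨z, hz0, hz1, hz2⟩ := hpos (-t) (by linarith)
      refine ⟨-z, fun h => by simp [hz0 (by simp [h])], ?_, ?_⟩
      · rw [Int.cast_neg, mul_neg, abs_neg, ← abs_neg t]; exact hz1
      · rw [Int.cast_neg, mul_neg, ← abs_neg]
        convert hz2 using 2; ring
  choose z hz0 hz1 hz2 using fun i => key (a i)
  have hsub : ∀ i, a i = 0 → z i = 0 := fun i => hz0 i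
  refine ⟨z, mem_sparseInt.2 ⟨?_, ?_⟩, _, rfl, ?_, ?_, ?_⟩
  · refine (Finset.card_le_card fun i hi => ?_).trans ha
    rw [Finset.mem_filter] at hi
    exact mem_vsupp.2 fun h => hi.2 (hsub i h)
  · have h2 : ∀ i, δ * ((z i).natAbs : ℝ) ≤ |a i| := fun i => by
      have := hz1 i
      rwa [abs_mul, abs_of_pos hδ0, ← Int.cast_abs, Int.abs_eq_natAbs, Int.cast_natCast] at this
    have h3 : δ * ((∑ i, (z i).natAbs : ℕ) : ℝ) ≤ Real.sqrt m := by
      rw [Nat.cast_sum, Finset.mul_sum]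
      refine (Finset.sum_le_sum fun i _ => h2 i).trans ?_
      rw [← Finset.sum_subset (Finset.subset_univ (vsupp a)) fun i _ hi => by
        rw [mem_vsupp, not_not] at hi; simp [hi]]
      exact sum_abs_le_of_vsupp ha h1
    have h4 : ((∑ i, (z i).natAbs : ℕ) : ℝ) ≤ 32 * m * y := by
      rw [hδ, one_div, inv_mul_le_iff₀ (by positivity)] at h3
      calc _ ≤ _ := h3
        _ = 32 * y * Real.sqrt m ^ 2 := by ring
        _ = _ := by rw [hsm2]; ring
    exact_mod_cast h4
  · intro i hi
    rw [mem_vsupp] at hi ⊢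
    intro h
    exact hi (by simp [hsub i h])
  · exact (Finset.sum_le_sum fun i _ => sq_le_sq.2 (hz1 i)).trans h1
  · have h2 : ∀ i, (a - fun i => δ * (z i : ℝ)) i ^ 2 ≤ if i ∈ vsupp a then δ ^ 2 else 0 := by
      intro i
      rw [Pi.sub_apply]
      split_ifs with hi
      · exact sq_le_sq.2 ((hz2 i).trans (le_abs_self _))
      · rw [mem_vsupp, not_not] at hi
        simp [hi, hsub i hi]
    refine (Finset.sum_le_sum fun i _ => h2 i).trans ?_
    rw [← Finset.sum_filter, Finset.filter_mem_eq_inter, Finset.univ_inter, Finset.sum_const,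
      nsmul_eq_mul]
    calc _ ≤ (m : ℝ) * δ ^ 2 := by gcongr
      _ = _ := by
        rw [hδ, div_pow, mul_pow, mul_pow, hsm2]
        field_simp

theorem continuous_zker_right {d k : ℕ} (u : EuclideanSpace ℝ (Fin d)) :
    Continuous fun x => zker k u x := by
  unfold zker dotp
  fun_prop

theorem continuous_zker {d k : ℕ} :
    Continuous fun x : EuclideanSpace ℝ (Fin d) × EuclideanSpace ℝ (Fin d) => zker k x.1 x.2 := by
  unfold zker dotp
  fun_prop

/-- Tail bound for a combination of zonal functions at a random point. -/
theorem gramForm_tail_le {d k : ℕ} (hd : 2 ≤ d) {σ : Measure (EuclideanSpace ℝ (Fin d))}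
    (hσ : IsSphereLaw σ) {ι : Type*} [Fintype ι]
    {w : ι → EuclideanSpace ℝ (Fin d)} (hw : ∀ i, ‖w i‖ = 1) (b : ι → ℝ) (q : ℕ) {s : ℝ}
    (hs : 0 < s) :
    σ {x | s * ∑ i, ∑ j, b i * b j * zker k (w i) (w j) < (∑ i, b i * zker k (w i) x) ^ 2}
      ≤ ENNReal.ofReal (((2 * (q : ℝ) + 3) ^ k / (sphDim d k * s)) ^ (q + 2)) := by
  have := hσ.prob
  have hN : (0 : ℝ) < sphDim d k := by exact_mod_cast sphDim_pos hd k
  set R := ∑ i, ∑ j, b i * b j * zker k (w i) (w j) with hR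
  have hR0 : 0 ≤ R := gramForm_nonneg hd hσ hw b
  set g : EuclideanSpace ℝ (Fin d) → ℝ := fun x => ∑ i, b i * zker k (w i) x with hg
  have hgc : Continuous g :=
    continuous_finsetSum _ fun i _ => continuous_const.mul (continuous_zker_right _)
  have hmom : ∫ x, g x ^ (2 * (q + 2)) ∂σ ≤ ((2 * (q : ℝ) + 3) ^ k * (R / sphDim d k)) ^ (q + 2) :=
    integral_gramForm_pow_le hd hσ hw b q
  have hint : Integrable (fun x => g x ^ (2 * (q + 2))) σ := hσ.integrable (hgc.pow _)
  have hnn : 0 ≤ fun x => g x ^ (2 * (q + 2)) := fun x => by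
    simp only [pow_mul, Pi.zero_apply]; positivity
  change σ {x | s * R < g x ^ 2} ≤ _
  rcases hR0.eq_or_lt with h0 | h0
  · have h1 : ∫ x, g x ^ (2 * (q + 2)) ∂σ = 0 := by
      refine le_antisymm (hmom.trans ?_) (integral_nonneg hnn)
      rw [← h0]; simp
    have h2 := (integral_eq_zero_iff_of_nonneg hnn hint).1 h1
    refine le_of_eq_of_le ?_ zero_le
    rw [← h0]
    refine measure_mono_null ?_ h2
    intro x hx hx0
    have : g x = 0 := by simpa using hx0
    simp [this] at hx
  · have h1 := mul_meas_ge_le_integral_of_nonneg (Eventually.of_forall hnn) hint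
      ((s * R) ^ (q + 2))
    have hpos : 0 < (s * R) ^ (q + 2) := by positivity
    have h2 : σ.real {x | (s * R) ^ (q + 2) ≤ g x ^ (2 * (q + 2))}
        ≤ ((2 * (q : ℝ) + 3) ^ k / (sphDim d k * s)) ^ (q + 2) := by
      rw [← mul_le_mul_iff_right₀ hpos]
      refine (h1.trans hmom).trans (le_of_eq ?_)
      rw [← mul_pow]
      congr 1
      field_simp
    rw [← ENNReal.ofReal_toReal (measure_ne_top σ _)]
    refine ENNReal.ofReal_le_ofReal (le_trans ?_ h2)
    refine measureReal_mono fun x hx => ?_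
    simp only [Set.mem_ofPred_eq] at hx ⊢
    rw [pow_mul]
    exact pow_le_pow_left₀ (by positivity) hx.le _

/-- Events attached to distinct coordinates are conditionally independent given the other
coordinates. -/
theorem pi_forall_mem_le {ι E : Type*} [Fintype ι] [MeasurableSpace E]
    (σ : Measure E) [IsProbabilityMeasure σ] (P : ι → Prop) [DecidablePred P]
    {T : Set (({i // ¬ P i} → E) × E)} (hT : MeasurableSet T) {c : ENNReal}
    (hc : ∀ y, σ {x | (y, x) ∈ T} ≤ c) :
    (Measure.pi fun _ : ι => σ) {w | ∀ l, P l → (fun i : {i // ¬ P i} => w i, w l) ∈ T}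
      ≤ c ^ Fintype.card {i // P i} := by
  have he := measurePreserving_piEquivPiSubtypeProd (fun _ : ι => σ) P
  set B : Set (({i // P i} → E) × ({i // ¬ P i} → E)) :=
    {zy | ∀ l : {i // P i}, (zy.2, zy.1 l) ∈ T} with hB
  have hBm : MeasurableSet B := by
    rw [hB, Set.ofPred_forall]
    refine MeasurableSet.iInter fun l => hT.preimage ?_
    exact measurable_snd.prodMk ((measurable_pi_apply l).comp measurable_fst)
  have h1 : {w : ι → E | ∀ l, P l → (fun i : {i // ¬ P i} => w i, w l) ∈ T}
      = (MeasurableEquiv.piEquivPiSubtypeProd (fun _ : ι => E) P) ⁻¹' B := by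
    ext w
    simp only [hB, Set.mem_preimage, Set.mem_ofPred_eq, Subtype.forall]
    rfl
  rw [h1, he.measure_preimage hBm.nullMeasurableSet, Measure.prod_apply_symm hBm]
  refine (lintegral_mono (g := fun _ => c ^ Fintype.card {i // P i}) fun y => ?_).trans (by simp)
  have h3 : (fun z : {i // P i} → E => (z, y)) ⁻¹' B
      = Set.univ.pi fun _ => {x | (y, x) ∈ T} := by
    ext z; simp [hB]
  rw [h3, Measure.pi_pi, Finset.prod_const, Finset.card_univ]
  exact pow_le_pow_left₀ zero_le (hc y) _

theorem sum_eq_sum_not_mem {ι : Type*} [Fintype ι] [DecidableEq ι] (S : Finset ι) {f : ι → ℝ}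
    (hf : ∀ i ∈ S, f i = 0) : ∑ i, f i = ∑ i : {i // ¬ i ∈ S}, f i := by
  rw [← Finset.sum_subtype Sᶜ (fun i => Finset.mem_compl)]
  exact (Finset.sum_subset (Finset.subset_univ _) fun i _ hi => hf i (by simpa using hi)).symm

theorem rows_exceed_le {d k n : ℕ} (hd : 2 ≤ d) {σ : Measure (EuclideanSpace ℝ (Fin d))}
    (hσ : IsSphereLaw σ) (a : Fin n → ℝ) (q : ℕ) {s : ℝ} (hs : 0 < s) (S : Finset (Fin n)) :
    (Measure.pi fun _ : Fin n => σ) {w | (∀ i, ‖w i‖ = 1) ∧ ∀ l ∈ S, a l = 0 ∧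
      s * qform (fun i j => zker k (w i) (w j)) a a < (∑ j, zker k (w l) (w j) * a j) ^ 2}
      ≤ ENNReal.ofReal (((2 * (q : ℝ) + 3) ^ k / (sphDim d k * s)) ^ (q + 2)) ^ S.card := by
  have := hσ.prob
  set c := ENNReal.ofReal (((2 * (q : ℝ) + 3) ^ k / (sphDim d k * s)) ^ (q + 2))
  by_cases haS : ∀ l ∈ S, a l = 0
  · set T : Set (({i // ¬ i ∈ S} → EuclideanSpace ℝ (Fin d)) × EuclideanSpace ℝ (Fin d)) :=
      {yx | (∀ i, ‖yx.1 i‖ = 1) ∧ s * ∑ i : {i // ¬ i ∈ S}, ∑ j : {i // ¬ i ∈ S},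
        a i * a j * zker k (yx.1 i) (yx.1 j) < (∑ i : {i // ¬ i ∈ S}, a i * zker k (yx.1 i) yx.2) ^ 2} with hTd
    have hT : MeasurableSet T := by
      rw [hTd, Set.ofPred_and, Set.ofPred_forall]
      refine MeasurableSet.inter (MeasurableSet.iInter fun i => ?_) ?_
      · exact (isClosed_eq (by fun_prop) continuous_const).measurableSet
      · refine (isOpen_lt ?_ ?_).measurableSet
        · refine continuous_const.mul (continuous_finsetSum _ fun i _ =>
            continuous_finsetSum _ fun j _ => continuous_const.mul ?_)
          exact continuous_zker.comp (f := fun yx : ({i // ¬ i ∈ S} → EuclideanSpace ℝ (Fin d)) ×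
            EuclideanSpace ℝ (Fin d) => (yx.1 i, yx.1 j)) (by fun_prop)
        · refine (continuous_finsetSum _ fun i _ => continuous_const.mul ?_).pow 2
          exact continuous_zker.comp (f := fun yx : ({i // ¬ i ∈ S} → EuclideanSpace ℝ (Fin d)) ×
            EuclideanSpace ℝ (Fin d) => (yx.1 i, yx.2)) (by fun_prop)
    have hc : ∀ y, σ {x | (y, x) ∈ T} ≤ c := by
      intro y
      by_cases hy : ∀ i, ‖y i‖ = 1
      · refine le_trans (measure_mono fun x hx => hx.2)
          (gramForm_tail_le (k := k) hd hσ hy (fun i => a i) q hs)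
      · have : {x | (y, x) ∈ T} = ∅ := by
          ext x
          simp only [hTd, Set.mem_ofPred_eq, Set.mem_empty_iff_false, iff_false]
          exact fun h => hy h.1
        rw [this, measure_empty]
        exact zero_le
    refine le_trans (measure_mono ?_) ((pi_forall_mem_le σ (fun i => i ∈ S) hT hc).trans
      (le_of_eq (congrArg (c ^ ·) (by
        rw [← Fintype.card_coe S]; congr!))))
    rintro w ⟨hw, hw2⟩ l hl
    refine ⟨fun i => hw i, ?_⟩
    have h1 := (hw2 l hl).2
    have h2 : qform (fun i j => zker k (w i) (w j)) a a = ∑ i : {i // ¬ i ∈ S},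
        ∑ j : {i // ¬ i ∈ S}, a i * a j * zker k (w i) (w j) := by
      rw [qform, sum_eq_sum_not_mem S (fun i hi => by simp [haS i hi])]
      exact Finset.sum_congr rfl fun i _ => sum_eq_sum_not_mem S fun j hj => by simp [haS j hj]
    rw [sum_eq_sum_not_mem S (fun j hj => by rw [haS j hj, mul_zero]), h2] at h1
    dsimp only
    convert h1 using 3
    rw [mul_comm, zker_comm]
  · refine le_of_eq_of_le ?_ zero_le
    rw [← measure_empty (μ := Measure.pi fun _ : Fin n => σ)]
    congr 1
    ext w
    simp only [Set.mem_ofPred_eq, Set.mem_empty_iff_false, iff_false]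
    exact fun h => haS fun l hl => (h.2 l hl).1

/-- Union bound over a finite net and over sets of rows. -/
theorem net_bad_le {d k n : ℕ} (hd : 2 ≤ d) {σ : Measure (EuclideanSpace ℝ (Fin d))}
    (hσ : IsSphereLaw σ) {α : Type*} (Z : Finset α) (f : α → Fin n → ℝ) (q h : ℕ) {s : ℝ}
    (hs : 0 < s) :
    (Measure.pi fun _ : Fin n => σ) {w | (∀ i, ‖w i‖ = 1) ∧ ∃ z ∈ Z,
      h ≤ (Finset.univ.filter fun l => f z l = 0 ∧
        s * qform (fun i j => zker k (w i) (w j)) (f z) (f z)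
          < (∑ j, zker k (w l) (w j) * f z j) ^ 2).card}
      ≤ ENNReal.ofReal ((Z.card : ℝ) * (n.choose h : ℝ) *
        (((2 * (q : ℝ) + 3) ^ k / (sphDim d k * s)) ^ (q + 2)) ^ h) := by
  set P := Finset.powersetCard h (Finset.univ : Finset (Fin n))
  have hc0 : 0 ≤ ((2 * (q : ℝ) + 3) ^ k / (sphDim d k * s)) ^ (q + 2) := by positivity
  refine le_trans (measure_mono (t := ⋃ zS ∈ Z ×ˢ P, {w | (∀ i, ‖w i‖ = 1) ∧ ∀ l ∈ zS.2,
    f zS.1 l = 0 ∧ s * qform (fun i j => zker k (w i) (w j)) (f zS.1) (f zS.1)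
      < (∑ j, zker k (w l) (w j) * f zS.1 j) ^ 2}) ?_) ?_
  · rintro w ⟨hw, z, hz, hcard⟩
    obtain ⟨S, hS, hSc⟩ := Finset.exists_subset_card_eq hcard
    simp only [Set.mem_iUnion]
    refine ⟨(z, S), Finset.mem_product.2 ⟨hz, Finset.mem_powersetCard.2
      ⟨Finset.subset_univ _, hSc⟩⟩, hw, fun l hl => ?_⟩
    exact (Finset.mem_filter.1 (hS hl)).2
  · refine (measure_biUnion_finset_le _ _).trans ?_
    refine (Finset.sum_le_card_nsmul _ _ (ENNReal.ofReal
      (((2 * (q : ℝ) + 3) ^ k / (sphDim d k * s)) ^ (q + 2)) ^ h) fun zS hzS => ?_).trans ?_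
    · have := (Finset.mem_powersetCard.1 (Finset.mem_product.1 hzS).2).2
      rw [← this]
      exact rows_exceed_le hd hσ (f zS.1) q hs zS.2
    · rw [Finset.card_product, Finset.card_powersetCard, Finset.card_univ, Fintype.card_fin,
        nsmul_eq_mul, ENNReal.ofReal_mul (by positivity), ← Nat.cast_mul, ENNReal.ofReal_natCast,
        ENNReal.ofReal_pow hc0]

theorem lintegral_rpow_le_of_bad {Ω : Type*} [MeasurableSpace Ω] {μ : Measure Ω}
    [IsProbabilityMeasure μ] {f : Ω → ℝ} (hf : ∀ w, 0 ≤ f w) {K M r : ℝ} (hr : 0 ≤ r)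
    (bad : Set Ω) (hM : ∀ᵐ w ∂μ, f w ≤ M) (hbad : ∀ᵐ w ∂μ, w ∉ bad → f w ≤ K) :
    ∫⁻ w, ENNReal.ofReal (f w ^ r) ∂μ
      ≤ ENNReal.ofReal (K ^ r) + ENNReal.ofReal (M ^ r) * μ bad := by
  calc ∫⁻ w, ENNReal.ofReal (f w ^ r) ∂μ
      ≤ ∫⁻ w, (ENNReal.ofReal (K ^ r) + bad.indicator (fun _ => ENNReal.ofReal (M ^ r)) w) ∂μ := by
        refine lintegral_mono_ae ?_
        filter_upwards [hM, hbad] with w h1 h2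
        by_cases hw : w ∈ bad
        · rw [Set.indicator_of_mem hw]
          exact (ENNReal.ofReal_le_ofReal (Real.rpow_le_rpow (hf w) h1 hr)).trans le_add_self
        · exact (ENNReal.ofReal_le_ofReal (Real.rpow_le_rpow (hf w) (h2 hw) hr)).trans le_self_add
    _ ≤ _ := by
        rw [lintegral_add_left measurable_const, lintegral_const, measure_univ, mul_one]
        gcongr
        exact lintegral_indicator_const_le _ _

theorem le_mul_two_pow {i j J : ℕ} (h : i + j + 1 = J) : J ≤ (j + 1) * 2 ^ i := by
  have h1 : i + 1 ≤ 2 ^ i := Nat.lt_two_pow_self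
  calc J ≤ (j + 1) * (i + 1) := by rw [← h]; ring_nf; omega
    _ ≤ _ := Nat.mul_le_mul_left _ h1

/-- The numerical estimate behind the union bound at one sparsity level. -/
theorem level_estimate {ρ i j J : ℕ} (hij : i + j + 1 = J) {B C Γ N : ℝ} (hB : 0 < B) (hN : 0 < N)
    (hJ : (2 : ℝ) ^ J ≤ C * N) (hΓ : C * B * 2 ^ (24 + ρ) ≤ Γ) :
    (2 ^ 10 * ((2 ^ j : ℕ) : ℝ) ^ 2) ^ (2 * 2 ^ i) * (8 * ((2 ^ j : ℕ) : ℝ)) ^ (2 ^ i) *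
      ((B / (N * (Γ / 2 ^ J * (81 / 50) ^ j))) ^ (2 * ρ + 10 + 2)) ^ (2 ^ i)
      ≤ (1 / 2 ^ J) ^ (ρ + 1) := by
  have hC : 0 < C := by
    have : 0 < C * N := lt_of_lt_of_le (by positivity) hJ
    exact pos_of_mul_pos_left this hN.le
  have hΓ0 : 0 < Γ := lt_of_lt_of_le (by positivity) hΓ
  have h1 : B / (N * (Γ / 2 ^ J * (81 / 50) ^ j)) ≤ 1 / 2 ^ (24 + ρ) * (1 / (81 / 50) ^ j) := by
    rw [div_le_iff₀ (by positivity)]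
    have h2 : B * 2 ^ J * 2 ^ (24 + ρ) ≤ N * Γ := by
      calc B * 2 ^ J * 2 ^ (24 + ρ) ≤ B * (C * N) * 2 ^ (24 + ρ) := by gcongr
        _ = N * (C * B * 2 ^ (24 + ρ)) := by ring
        _ ≤ N * Γ := by gcongr
    have e : 1 / 2 ^ (24 + ρ) * (1 / (81 / 50) ^ j) * (N * (Γ / 2 ^ J * (81 / 50 : ℝ) ^ j))
        = N * Γ / (2 ^ J * 2 ^ (24 + ρ)) := by
      field_simp
    rw [e, le_div_iff₀ (by positivity)]
    linarith
  have h3 : (B / (N * (Γ / 2 ^ J * (81 / 50) ^ j))) ^ (2 * ρ + 10 + 2)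
      ≤ 1 / 2 ^ (24 + ρ) * (1 / ((2 ^ j : ℕ) : ℝ) ^ (ρ + 6)) := by
    have hl : (1 : ℝ) ≤ 2 ^ (24 + ρ) := one_le_pow₀ (by norm_num)
    calc _ ≤ (1 / 2 ^ (24 + ρ) * (1 / (81 / 50) ^ j)) ^ (2 * ρ + 10 + 2) := by
          gcongr
      _ = (1 / 2 ^ (24 + ρ)) ^ (2 * ρ + 10 + 2) * (1 / ((81 / 50 : ℝ) ^ (2 * (ρ + 6))) ^ j) := by
          rw [mul_pow, one_div_pow ((81 / 50 : ℝ) ^ j), ← pow_mul (81 / 50 : ℝ),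
            ← pow_mul (81 / 50 : ℝ), mul_comm j, mul_add 2 ρ 6]
      _ ≤ 1 / 2 ^ (24 + ρ) * (1 / ((2 : ℝ) ^ (ρ + 6)) ^ j) := by
          gcongr
          · refine pow_le_of_le_one (by positivity) ?_ (by omega)
            exact (div_le_one (by positivity)).2 hl
          · rw [pow_mul]
            gcongr
            norm_num
      _ = _ := by
          push_cast
          rw [← pow_mul, ← pow_mul, mul_comm j]
  rw [pow_mul _ 2, ← mul_pow, ← mul_pow]
  have h4 : (2 ^ 10 * ((2 ^ j : ℕ) : ℝ) ^ 2) ^ 2 * (8 * ((2 ^ j : ℕ) : ℝ)) *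
      (B / (N * (Γ / 2 ^ J * (81 / 50) ^ j))) ^ (2 * ρ + 10 + 2) ≤ (1 / 2 ^ (ρ + 1)) ^ (j + 1) := by
    have hy : (0 : ℝ) < ((2 ^ j : ℕ) : ℝ) := by positivity
    calc _ ≤ (2 ^ 10 * ((2 ^ j : ℕ) : ℝ) ^ 2) ^ 2 * (8 * ((2 ^ j : ℕ) : ℝ)) *
          (1 / 2 ^ (24 + ρ) * (1 / ((2 ^ j : ℕ) : ℝ) ^ (ρ + 6))) := by gcongr
      _ = 1 / 2 ^ (ρ + 1) * (1 / ((2 ^ j : ℕ) : ℝ) ^ (ρ + 1)) := by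
          generalize ((2 ^ j : ℕ) : ℝ) = y at hy
          have e1 : (2 : ℝ) ^ (24 + ρ) = 2 ^ 23 * 2 ^ (ρ + 1) := by ring
          have e2 : y ^ (ρ + 6) = y ^ 5 * y ^ (ρ + 1) := by ring
          rw [e1, e2]
          field_simp
          norm_num
      _ = _ := by
          push_cast
          rw [← pow_mul, pow_succ _ j, one_div_pow, ← pow_mul, mul_comm j, mul_comm]
  calc _ ≤ ((1 / 2 ^ (ρ + 1) : ℝ) ^ (j + 1)) ^ (2 ^ i) := by gcongr
    _ = (1 / 2 ^ (ρ + 1) : ℝ) ^ ((j + 1) * 2 ^ i) := by rw [← pow_mul]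
    _ ≤ (1 / 2 ^ (ρ + 1) : ℝ) ^ J := by
        refine pow_le_pow_of_le_one (by positivity) ?_ (le_mul_two_pow hij)
        exact (div_le_one (by positivity)).2 (one_le_pow₀ (by norm_num))
    _ = _ := by rw [one_div_pow, one_div_pow, ← pow_mul, ← pow_mul, mul_comm]

theorem ae_pi_norm_eq_one {d n : ℕ} {σ : Measure (EuclideanSpace ℝ (Fin d))} (hσ : IsSphereLaw σ) :
    ∀ᵐ w ∂(Measure.pi fun _ : Fin n => σ), ∀ i, ‖w i‖ = 1 := by
  have := hσ.prob
  rw [ae_all_iff]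
  exact fun i => (Measure.quasiMeasurePreserving_eval (fun _ : Fin n => σ) i).ae hσ.norm_eq_one

/-- The Gram matrix has bounded norm outside an event of small probability. -/
theorem gram_bad_le {d k n J ρ : ℕ} (hd : 2 ≤ d) {σ : Measure (EuclideanSpace ℝ (Fin d))}
    (hσ : IsSphereLaw σ) (hn : n ≤ 2 ^ J) {C Γ : ℝ} (hJ : (2 : ℝ) ^ J ≤ C * sphDim d k)
    (hΓ : C * (2 * ((2 * ρ + 10 : ℕ) : ℝ) + 3) ^ k * 2 ^ (24 + ρ) ≤ Γ) :
    (Measure.pi fun _ : Fin n => σ) {w | (∀ i, ‖w i‖ = 1) ∧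
      ¬ opNorm (Matrix.of fun i j => zker k (w i) (w j)) ≤ 20 + 25600 * Γ}
      ≤ ENNReal.ofReal ((1 / 2 ^ J) ^ ρ) := by
  have hN : (0 : ℝ) < sphDim d k := by exact_mod_cast sphDim_pos hd k
  set B : ℝ := (2 * ((2 * ρ + 10 : ℕ) : ℝ) + 3) ^ k with hB
  have hB0 : 0 < B := by positivity
  have hC : 0 < C := by
    have : 0 < C * (sphDim d k : ℝ) := lt_of_lt_of_le (by positivity) hJ
    exact pos_of_mul_pos_left this hN.le
  have hΓ0 : 0 < Γ := lt_of_lt_of_le (by positivity) hΓ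
  set s2 : ℕ → ℝ := fun i => Γ / 2 ^ J * (81 / 50) ^ (J - 1 - i) with hs2d
  have hs2 : ∀ i, 0 < s2 i := fun i => by positivity
  set η : ℕ → ℝ := fun i => 1 / (32 * ((2 ^ (J - 1 - i) : ℕ) : ℝ)) with hη
  set Z : (i : ℕ) → Finset (Fin n → ℤ) := fun i =>
    sparseInt n (2 * 2 ^ i) (32 * (2 * 2 ^ i) * 2 ^ (J - 1 - i)) with hZ
  set f : ℕ → (Fin n → ℤ) → Fin n → ℝ := fun i z l =>
    1 / (32 * ((2 ^ (J - 1 - i) : ℕ) : ℝ) * Real.sqrt (2 * 2 ^ i : ℕ)) * (z l : ℝ) with hf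
  set bad : ℕ → Set (Fin n → EuclideanSpace ℝ (Fin d)) := fun i => {w | (∀ i, ‖w i‖ = 1) ∧ ∃ z ∈ Z i,
      2 ^ i ≤ (Finset.univ.filter fun l => f i z l = 0 ∧
        s2 i * qform (fun i j => zker k (w i) (w j)) (f i z) (f i z)
          < (∑ j, zker k (w l) (w j) * f i z j) ^ 2).card} with hbad
  have hE : ∑ i ∈ Finset.range J, Real.sqrt ((2 * 2 ^ i : ℕ) * s2 i) ≤ 10 * Real.sqrt Γ := by
    have h1 : ∀ i ∈ Finset.range J, Real.sqrt ((2 * 2 ^ i : ℕ) * s2 i)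
        = Real.sqrt Γ * (9 / 10) ^ (J - 1 - i) := by
      intro i hi
      obtain ⟨j, hj⟩ : ∃ j, i + j + 1 = J := ⟨J - 1 - i, by have := Finset.mem_range.1 hi; omega⟩
      have e : J - 1 - i = j := by omega
      have e2 : ((2 * 2 ^ i : ℕ) : ℝ) * s2 i = Γ * ((9 / 10) ^ j) ^ 2 := by
        simp only [hs2d, e]
        rw [← hj, ← pow_mul, mul_comm j 2, pow_mul,
          show (81 / 50 : ℝ) = 2 * (9 / 10) ^ 2 by norm_num, mul_pow]
        push_cast
        field_simp
        ring
      rw [e2, Real.sqrt_mul hΓ0.le, Real.sqrt_sq (by positivity), e]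
    rw [Finset.sum_congr rfl h1, Finset.sum_range_reflect (fun j => Real.sqrt Γ * (9 / 10) ^ j),
      ← Finset.mul_sum, mul_comm]
    gcongr
    rw [geom_sum_eq (by norm_num)]
    have : (0 : ℝ) < (9 / 10) ^ J := by positivity
    rw [div_le_iff_of_neg (by norm_num)]
    linarith
  have hηs : ∑ i ∈ Finset.range J, η i ≤ 1 / 16 := by
    have h1 : ∀ i ∈ Finset.range J, η i = 1 / 32 * (1 / 2) ^ (J - 1 - i) := by
      intro i _
      simp only [hη]
      push_cast
      rw [one_div_pow, one_div_mul_one_div]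
    rw [Finset.sum_congr rfl h1, Finset.sum_range_reflect (fun j => 1 / 32 * (1 / 2 : ℝ) ^ j),
      ← Finset.mul_sum, geom_sum_eq (by norm_num)]
    have : (0 : ℝ) < (1 / 2) ^ J := by positivity
    rw [show (1 / 2 : ℝ) - 1 = -(1 / 2) by norm_num, div_neg, div_div_eq_mul_div]
    linarith
  refine le_trans (measure_mono (t := ⋃ i ∈ Finset.range J, bad i) ?_) ?_
  · rintro w ⟨hw, hw2⟩
    by_contra hcon
    simp only [Set.mem_iUnion, not_exists] at hcon
    refine hw2 ?_
    have hG := isCorr_zker (k := k) hd hσ hw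
    have := hG.opNorm_le_of_chaining hn (fun i => (hs2 i).le) (η := η) (fun i => by positivity)
      (fun i => {a | ∃ z ∈ Z i, a = f i z}) ?_ ?_ hE hηs
    · refine this.trans (le_of_eq ?_)
      rw [mul_pow, Real.sq_sqrt hΓ0.le]; ring
    · intro i hi a ha h1
      obtain ⟨z, hz, a', rfl, h2, h3, h4⟩ := exists_sparseInt_near (m := 2 * 2 ^ i)
        (y := 2 ^ (J - 1 - i)) (by have := Nat.one_le_two_pow (n := i); omega) Nat.one_le_two_pow
        ha h1
      exact ⟨_, ⟨z, hz, rfl⟩, h2, h3, h4⟩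
    · rintro i hi a ⟨z, hz, rfl⟩
      by_contra hle
      exact hcon i (Finset.mem_range.2 hi) ⟨hw, z, hz, not_lt.1 hle⟩
  · refine (measure_biUnion_finset_le _ _).trans ?_
    have hlev : ∀ i ∈ Finset.range J, (Measure.pi fun _ : Fin n => σ) (bad i)
        ≤ ENNReal.ofReal ((1 / 2 ^ J) ^ (ρ + 1)) := by
      intro i hi
      obtain ⟨j, hj⟩ : ∃ j, i + j + 1 = J := ⟨J - 1 - i, by have := Finset.mem_range.1 hi; omega⟩
      have e : J - 1 - i = j := by omega
      have hnm : n ≤ 2 * 2 ^ i * 2 ^ j := by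
        refine hn.trans (le_of_eq ?_)
        rw [← hj]; ring
      refine (net_bad_le hd hσ (Z i) (f i) (2 * ρ + 10) (2 ^ i) (hs2 i)).trans
        (ENNReal.ofReal_le_ofReal ?_)
      refine le_trans ?_ (level_estimate hj hB0 hN hJ hΓ)
      simp only [hs2d, hZ, e]
      have c1 := card_sparseInt_le (n := n) (m := 2 * 2 ^ i) (y := 2 ^ j) Nat.one_le_two_pow hnm
      have c2 := choose_le_pow (n := n) (h := 2 ^ i) (y := 2 ^ j) Nat.one_le_two_pow hnm
      gcongr
    refine (Finset.sum_le_card_nsmul _ _ _ hlev).trans ?_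
    rw [Finset.card_range, nsmul_eq_mul, ← ENNReal.ofReal_natCast, ← ENNReal.ofReal_mul (by positivity)]
    refine ENNReal.ofReal_le_ofReal ?_
    have h1 : (J : ℝ) ≤ 2 ^ J := by exact_mod_cast (Nat.lt_two_pow_self (n := J)).le
    calc (J : ℝ) * (1 / 2 ^ J) ^ (ρ + 1) ≤ 2 ^ J * (1 / 2 ^ J) ^ (ρ + 1) := by gcongr
      _ = (1 / 2 ^ J) ^ ρ := by
        rw [pow_succ]; field_simp

theorem lintegral_gram_rpow_le {d k n J ρ : ℕ} (hd : 2 ≤ d)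
    {σ : Measure (EuclideanSpace ℝ (Fin d))}
    (hσ : IsSphereLaw σ) (hn : n ≤ 2 ^ J) {C Γ r : ℝ} (hr : 0 ≤ r) (hrρ : r ≤ ρ)
    (hJ : (2 : ℝ) ^ J ≤ C * sphDim d k)
    (hΓ : C * (2 * ((2 * ρ + 10 : ℕ) : ℝ) + 3) ^ k * 2 ^ (24 + ρ) ≤ Γ) (hΓ0 : 0 ≤ Γ) :
    ∫⁻ w, ENNReal.ofReal (opNorm (Matrix.of fun i j => zker k (w i) (w j)) ^ r)
      ∂(Measure.pi fun _ : Fin n => σ) ≤ ENNReal.ofReal ((20 + 25600 * Γ) ^ r + 1) := by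
  have := hσ.prob
  have h1 := ae_pi_norm_eq_one (n := n) hσ
  refine (lintegral_rpow_le_of_bad (M := (2 : ℝ) ^ J) (K := 20 + 25600 * Γ)
    (fun w => opNorm_of_nonneg _) hr
    {w | (∀ i, ‖w i‖ = 1) ∧
      ¬ opNorm (Matrix.of fun i j => zker k (w i) (w j)) ≤ 20 + 25600 * Γ} ?_ ?_).trans ?_
  · filter_upwards [h1] with w hw
    refine (isCorr_zker (k := k) hd hσ hw).opNorm_le_card.trans ?_
    exact_mod_cast hn
  · filter_upwards [h1] with w hw hb
    by_contra h
    exact hb ⟨hw, h⟩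
  · rw [ENNReal.ofReal_add (by positivity) zero_le_one]
    gcongr
    refine (mul_le_mul_right (gram_bad_le hd hσ hn hJ hΓ) _).trans ?_
    rw [← ENNReal.ofReal_mul (by positivity)]
    refine ENNReal.ofReal_le_ofReal ?_
    have h2 : (1 : ℝ) ≤ 2 ^ J := one_le_pow₀ (by norm_num)
    have h3 : ((2 : ℝ) ^ J) ^ r ≤ ((2 : ℝ) ^ J) ^ ρ := by
      rw [← Real.rpow_natCast (((2 : ℝ) ^ J)) ρ]
      exact Real.rpow_le_rpow_of_exponent_le h2 hrρ
    rw [one_div_pow, mul_one_div]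
    exact (div_le_one (by positivity)).2 h3

theorem zker_tail_le {d k : ℕ} (hd : 2 ≤ d) {σ : Measure (EuclideanSpace ℝ (Fin d))}
    (hσ : IsSphereLaw σ) {u : EuclideanSpace ℝ (Fin d)} (hu : ‖u‖ = 1) {ε : ℝ} (hε : 0 < ε) :
    σ {x | ε < |zker k u x|} ≤ ENNReal.ofReal (1 / (sphDim d k * ε ^ 2)) := by
  have := hσ.prob
  have hN : (0 : ℝ) < sphDim d k := by exact_mod_cast sphDim_pos hd k
  have h1 := mul_meas_ge_le_integral_of_nonneg (μ := σ) (f := fun x => zker k u x ^ 2)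
    (Eventually.of_forall fun x => sq_nonneg _)
    (hσ.integrable ((continuous_zker_right u).pow 2)) (ε ^ 2)
  rw [integral_zker_sq hd hσ hu] at h1
  rw [← ENNReal.ofReal_toReal (measure_ne_top σ _)]
  refine ENNReal.ofReal_le_ofReal ?_
  have h2 : σ.real {x | ε < |zker k u x|} ≤ σ.real {x | ε ^ 2 ≤ zker k u x ^ 2} := by
    refine measureReal_mono fun x hx => ?_
    simp only [Set.mem_ofPred_eq] at hx ⊢
    rw [← sq_abs (zker k u x)]
    exact pow_le_pow_left₀ hε.le hx.le 2
  refine h2.trans ?_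
  rw [← div_div, le_div_iff₀ (by positivity), mul_comm]
  exact h1

theorem pair_exceed_le {d k n : ℕ} (hd : 2 ≤ d) {σ : Measure (EuclideanSpace ℝ (Fin d))}
    (hσ : IsSphereLaw σ) {i j : Fin n} (hij : i ≠ j) {ε : ℝ} (hε : 0 < ε) :
    (Measure.pi fun _ : Fin n => σ) {w | (∀ i, ‖w i‖ = 1) ∧ ε < |zker k (w i) (w j)|}
      ≤ ENNReal.ofReal (1 / (sphDim d k * ε ^ 2)) := by
  have := hσ.prob
  set T : Set (({l // ¬ l = j} → EuclideanSpace ℝ (Fin d)) × EuclideanSpace ℝ (Fin d)) :=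
    {yx | ‖yx.1 ⟨i, hij⟩‖ = 1 ∧ ε < |zker k (yx.1 ⟨i, hij⟩) yx.2|} with hTd
  have hT : MeasurableSet T := by
    rw [hTd, Set.ofPred_and]
    refine MeasurableSet.inter (isClosed_eq (by fun_prop) continuous_const).measurableSet
      (isOpen_lt continuous_const (continuous_zker.comp
        (f := fun yx : ({l // ¬ l = j} → EuclideanSpace ℝ (Fin d)) × EuclideanSpace ℝ (Fin d) =>
          (yx.1 ⟨i, hij⟩, yx.2)) (by fun_prop)).abs).measurableSet
  have hc : ∀ y, σ {x | (y, x) ∈ T} ≤ ENNReal.ofReal (1 / (sphDim d k * ε ^ 2)) := by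
    intro y
    by_cases hy : ‖y ⟨i, hij⟩‖ = 1
    · exact le_trans (measure_mono fun x hx => hx.2) (zker_tail_le (k := k) hd hσ hy hε)
    · have : {x | (y, x) ∈ T} = ∅ := by
        ext x
        simp only [hTd, Set.mem_ofPred_eq, Set.mem_empty_iff_false, iff_false]
        exact fun h => hy h.1
      rw [this, measure_empty]
      exact zero_le
  have h1 := pi_forall_mem_le σ (fun l => l = j) hT hc
  refine (measure_mono ?_).trans (h1.trans (le_of_eq ?_))
  rotate_left
  · conv_rhs => rw [← pow_one (ENNReal.ofReal _)]
    congr 1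
    rw [← Fintype.card_unique (α := {l // l = j})]
    congr!
  rintro w ⟨hw, hw2⟩ l rfl
  exact ⟨hw i, hw2⟩

/-- Moment bound through the entrywise size of the Gram matrix, sharp for large degrees. -/
theorem lintegral_gram_rpow_le_entries {d k n : ℕ} (hd : 2 ≤ d) (hn : 0 < n)
    {σ : Measure (EuclideanSpace ℝ (Fin d))} (hσ : IsSphereLaw σ) {r : ℝ} (hr : 0 ≤ r) :
    ∫⁻ w, ENNReal.ofReal (opNorm (Matrix.of fun i j => zker k (w i) (w j)) ^ r)
      ∂(Measure.pi fun _ : Fin n => σ)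
      ≤ ENNReal.ofReal (2 ^ r + (n : ℝ) ^ (r + 4) / sphDim d k) := by
  have := hσ.prob
  have hN : (0 : ℝ) < sphDim d k := by exact_mod_cast sphDim_pos hd k
  have hn' : (0 : ℝ) < n := by exact_mod_cast hn
  have h1 := ae_pi_norm_eq_one (n := n) hσ
  set bad : Set (Fin n → EuclideanSpace ℝ (Fin d)) :=
    ⋃ ij ∈ (Finset.univ : Finset (Fin n × Fin n)).filter fun ij => ij.1 ≠ ij.2,
      {w | (∀ i, ‖w i‖ = 1) ∧ 1 / (n : ℝ) < |zker k (w ij.1) (w ij.2)|} with hbad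
  have hb : (Measure.pi fun _ : Fin n => σ) bad ≤ ENNReal.ofReal ((n : ℝ) ^ 4 / sphDim d k) := by
    refine (measure_biUnion_finset_le _ _).trans ((Finset.sum_le_card_nsmul _ _ _ fun ij hij =>
      pair_exceed_le hd hσ (Finset.mem_filter.1 hij).2 (one_div_pos.2 hn')).trans ?_)
    rw [nsmul_eq_mul, ← ENNReal.ofReal_natCast, ← ENNReal.ofReal_mul (by positivity)]
    refine ENNReal.ofReal_le_ofReal ?_
    have h2 : (((Finset.univ : Finset (Fin n × Fin n)).filter fun ij => ij.1 ≠ ij.2).card : ℝ)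
        ≤ n * n := by
      have := Finset.card_filter_le (Finset.univ : Finset (Fin n × Fin n)) fun ij => ij.1 ≠ ij.2
      rw [Finset.card_univ, Fintype.card_prod, Fintype.card_fin] at this
      exact_mod_cast this
    calc _ ≤ (n * n : ℝ) * (1 / (sphDim d k * (1 / (n : ℝ)) ^ 2)) := by gcongr
      _ = _ := by field_simp
  refine (lintegral_rpow_le_of_bad (M := n) (K := 2) (fun w => opNorm_of_nonneg _) hr bad
    ?_ ?_).trans ?_
  · filter_upwards [h1] with w hw
    exact (isCorr_zker (k := k) hd hσ hw).opNorm_le_card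
  · filter_upwards [h1] with w hw hwb
    refine (isCorr_zker (k := k) hd hσ hw).opNorm_le_two fun i j hij => ?_
    by_contra h
    refine hwb ?_
    simp only [hbad, Set.mem_iUnion]
    exact ⟨(i, j), Finset.mem_filter.2 ⟨Finset.mem_univ _, hij⟩, hw, not_le.1 h⟩
  · rw [ENNReal.ofReal_add (by positivity) (by positivity)]
    gcongr
    refine (mul_le_mul_right hb _).trans ?_
    rw [← ENNReal.ofReal_mul (by positivity), Real.rpow_add hn', mul_div_assoc]
    norm_cast

theorem pow_le_sphDim {d : ℕ} (hd : 2 ≤ d) (k : ℕ) :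
    (d : ℝ) ^ k ≤ 2 ^ k * (k.factorial : ℝ) * sphDim d k := by
  rcases k with _ | k
  · simp [sphDim]
  · obtain ⟨e, rfl⟩ : ∃ e, d = e + 2 := ⟨d - 2, by omega⟩
    have h1 : ((e + 1 : ℕ) : ℝ) ^ (k + 1)
        ≤ (k + 1).factorial * ((e + (k + 1)).choose (k + 1) : ℝ) := by
      have := Nat.pow_sub_le_descFactorial (e + (k + 1)) (k + 1)
      rw [Nat.descFactorial_eq_factorial_mul_choose,
        show e + (k + 1) + 1 - (k + 1) = e + 1 by omega] at this
      exact_mod_cast this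
    have h2 : ((e + (k + 1)).choose (k + 1) : ℝ) ≤ sphDim (e + 2) (k + 1) := by
      rw [(sphDim_add_two e k).1]
      push_cast
      rw [show e + (k + 1) = e + k + 1 by omega]
      linarith [(Nat.cast_nonneg ((e + k).choose k) : (0 : ℝ) ≤ _)]
    have h3 : ((e + 2 : ℕ) : ℝ) ≤ 2 * ((e + 1 : ℕ) : ℝ) := by
      push_cast
      linarith [(Nat.cast_nonneg e : (0 : ℝ) ≤ e)]
    calc ((e + 2 : ℕ) : ℝ) ^ (k + 1) ≤ (2 * ((e + 1 : ℕ) : ℝ)) ^ (k + 1) := by gcongr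
      _ = 2 ^ (k + 1) * ((e + 1 : ℕ) : ℝ) ^ (k + 1) := mul_pow _ _ _
      _ ≤ 2 ^ (k + 1) * ((k + 1).factorial * sphDim (e + 2) (k + 1)) := by
        gcongr
        exact h1.trans (by gcongr)
      _ = _ := by ring

theorem sphDim_mono {d : ℕ} (hd : 2 ≤ d) {k l : ℕ} (hk : 1 ≤ k) (hkl : k ≤ l) :
    sphDim d k ≤ sphDim d l := by
  induction l, hkl using Nat.le_induction with
  | base => exact le_rfl
  | succ l hl ih =>
    refine ih.trans ?_
    obtain ⟨e, rfl⟩ : ∃ e, d = e + 2 := ⟨d - 2, by omega⟩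
    obtain ⟨m, rfl⟩ : ∃ m, l = m + 1 := ⟨l - 1, by omega⟩
    rw [(sphDim_add_two e m).1, (sphDim_add_two e (m + 1)).1]
    have h1 := Nat.choose_succ_succ (e + m + 1) (m + 1)
    have h2 := Nat.choose_succ_succ (e + m) m
    simp only [Nat.succ_eq_add_one] at h1 h2
    rw [show e + (m + 1) = e + m + 1 by omega]
    omega

theorem IsGegenbauer.sq_add_sq_of_dim_one {k : ℕ} {q : Polynomial ℝ} (hq : IsGegenbauer 1 k q) :
    q.eval 1 ^ 2 + q.eval (-1) ^ 2 = 2 := by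
  have hσ := sphereUniform_isSphereLaw one_pos hq
  have := hσ.prob
  have hc : Continuous fun s : ℝ => q.eval s ^ 2 := by fun_prop
  have hg : Continuous fun x : EuclideanSpace ℝ (Fin 1) => q.eval (x 0) ^ 2 := by fun_prop
  have hg' : Continuous fun x : EuclideanSpace ℝ (Fin 1) => q.eval (-x 0) ^ 2 := by fun_prop
  have h1 : ∫ x : EuclideanSpace ℝ (Fin 1), q.eval (x 0) ^ 2 ∂sphereUniform 1 1 = 1 := by
    have := hq.2.2.1
    rw [integral_tau1 one_pos hc] at this
    simpa using this
  have h2 : ∫ x : EuclideanSpace ℝ (Fin 1), q.eval (-x 0) ^ 2 ∂sphereUniform 1 1 = 1 := by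
    have := hσ.integral_comp hg (LinearIsometryEquiv.neg ℝ)
    rw [h1] at this
    simpa using this
  have h3 : ∫ x : EuclideanSpace ℝ (Fin 1), (q.eval (x 0) ^ 2 + q.eval (-x 0) ^ 2)
      ∂sphereUniform 1 1 = 2 := by
    rw [integral_add (hσ.integrable hg) (hσ.integrable hg'), h1, h2]
    norm_num
  rw [← h3, integral_congr_ae (g := fun _ => q.eval 1 ^ 2 + q.eval (-1) ^ 2)]
  · simp
  · filter_upwards [hσ.norm_eq_one] with x hx
    have h4 := sum_sq_of_norm hx
    simp only [Fin.isValue, Finset.univ_unique, Fin.default_eq_zero, Finset.sum_singleton] at h4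
    rcases mul_self_eq_one_iff.1 ((sq _).symm.trans h4) with h | h
    · rw [h]
    · rw [h, neg_neg, add_comm]

theorem lintegral_QWmat_dim_one_le {k n : ℕ} {q : Polynomial ℝ} (hq : IsGegenbauer 1 k q)
    {r : ℝ} (hr : 0 ≤ r) :
    ∫⁻ w, ENNReal.ofReal (opNorm (QWmat 1 n q (sphDim 1 k) w) ^ r) ∂Wmeas 1 n
      ≤ ENNReal.ofReal ((2 * n : ℝ) ^ r) := by
  have hσ := sphereUniform_isSphereLaw one_pos hq
  have := hσ.prob
  have hb := hq.sq_add_sq_of_dim_one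
  have hN : sphDim 1 k = 0 ∨ sphDim 1 k = 1 := by
    rcases k with _ | _ | k
    · exact Or.inr rfl
    · exact Or.inr rfl
    · left
      rw [sphDim, if_neg (by omega), if_neg (by omega), Nat.choose_eq_zero_of_lt (by omega)]
      simp
  have hq2 : ∀ s : ℝ, s = 1 ∨ s = -1 → |q.eval s| ≤ 2 := by
    rintro s (rfl | rfl) <;> refine abs_le_of_sq_le_sq ?_ zero_le_two <;>
      nlinarith [sq_nonneg (q.eval 1), sq_nonneg (q.eval (-1))]
  rw [Wmeas]
  refine (lintegral_mono_ae (g := fun _ => ENNReal.ofReal ((2 * n : ℝ) ^ r)) ?_).trans (by simp)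
  filter_upwards [ae_pi_norm_eq_one (n := n) hσ] with w hw
  refine ENNReal.ofReal_le_ofReal (Real.rpow_le_rpow (opNorm_of_nonneg _) ?_ hr)
  refine opNorm_le_of_entries zero_le_two fun i j => ?_
  have hs : ∀ i, w i 0 = 1 ∨ w i 0 = -1 := fun i => by
    have h4 := sum_sq_of_norm (hw i)
    simp only [Fin.isValue, Finset.univ_unique, Fin.default_eq_zero, Finset.sum_singleton] at h4
    exact mul_self_eq_one_iff.1 ((sq _).symm.trans h4)
  have h5 : Real.sqrt (1 : ℕ) * dotp (w i) (w j) = 1 ∨ Real.sqrt (1 : ℕ) * dotp (w i) (w j) = -1 := by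
    simp only [dotp, Nat.cast_one, Real.sqrt_one, one_mul, Finset.univ_unique,
      Fin.default_eq_zero, Finset.sum_singleton]
    rcases hs i with h | h <;> rcases hs j with h' | h' <;> simp [h, h']
  rcases hN with h | h
  · simp [h]
  · simpa [h] using hq2 _ h5

theorem exists_bound_mul_rpow {p : ℕ → ℕ} {κ θ : ℝ}
    (hpl : Tendsto (fun d : ℕ => (p d : ℝ) / (d : ℝ) ^ κ) atTop (nhds θ)) :
    ∃ C : ℝ, 0 < C ∧ ∀ d : ℕ, 1 ≤ d → (p d : ℝ) ≤ C * (d : ℝ) ^ κ := by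
  obtain ⟨M, hM⟩ := hpl.bddAbove_range
  refine ⟨max M 1, by positivity, fun d hd => ?_⟩
  have hd' : (0 : ℝ) < (d : ℝ) ^ κ := Real.rpow_pos_of_pos (by exact_mod_cast hd) _
  rw [← div_le_iff₀ hd']
  exact (hM ⟨d, rfl⟩).trans (le_max_left _ _)

/-- Moment bound at a fixed degree `k`, uniformly in the dimension `d ≥ 2`. -/
theorem exists_bound_fixed_degree {C : ℝ} (hC : 0 < C) {r : ℝ} (hr : 0 ≤ r) (k : ℕ) :
    ∃ K : ℝ, 0 ≤ K ∧ ∀ d n : ℕ, 2 ≤ d → 0 < n → (n : ℝ) ≤ C * (d : ℝ) ^ k →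
      ∀ σ : Measure (EuclideanSpace ℝ (Fin d)), IsSphereLaw σ →
        ∫⁻ w, ENNReal.ofReal (opNorm (Matrix.of fun i j => zker k (w i) (w j)) ^ r)
          ∂(Measure.pi fun _ : Fin n => σ) ≤ ENNReal.ofReal K := by
  set C' : ℝ := 2 * (C * (2 ^ k * (k.factorial : ℝ))) with hC'
  set ρ := ⌈r⌉₊
  set Γ : ℝ := C' * (2 * ((2 * ρ + 10 : ℕ) : ℝ) + 3) ^ k * 2 ^ (24 + ρ) with hΓ
  have hC'0 : 0 ≤ C' := by positivity
  have hΓ0 : 0 ≤ Γ := by positivity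
  refine ⟨(20 + 25600 * Γ) ^ r + 1, by positivity, fun d n hd hn hnd σ hσ => ?_⟩
  refine lintegral_gram_rpow_le hd hσ (Nat.le_pow_clog one_lt_two n) hr (Nat.le_ceil r)
    (C := C') ?_ le_rfl hΓ0
  have h1 : (2 : ℝ) ^ Nat.clog 2 n ≤ 2 * n := by
    rcases Nat.lt_or_ge 1 n with h | h
    · have h2 := Nat.pow_pred_clog_lt_self one_lt_two h
      have h3 : 0 < Nat.clog 2 n := Nat.clog_pos one_lt_two h
      obtain ⟨m, hm⟩ : ∃ m, Nat.clog 2 n = m + 1 := ⟨Nat.clog 2 n - 1, by omega⟩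
      rw [hm, Nat.pred_succ] at h2
      rw [hm, pow_succ, mul_comm]
      gcongr
      exact_mod_cast h2.le
    · obtain rfl : n = 1 := by omega
      simp
  calc (2 : ℝ) ^ Nat.clog 2 n ≤ 2 * n := h1
    _ ≤ 2 * (C * (2 ^ k * (k.factorial : ℝ) * sphDim d k)) := by
      gcongr
      exact hnd.trans (by gcongr; exact pow_le_sphDim hd k)
    _ = C' * sphDim d k := by rw [hC']; ring

/-- Moment bound uniformly over large degrees `k` and dimensions `d ≥ 2`. -/
theorem lintegral_gram_large_degree_le {C κ r : ℝ} (hC : 0 < C) (hr : 0 ≤ r) {k₀ : ℕ}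
    (hk₀ : 1 ≤ k₀) (hκ : κ * (r + 4) ≤ k₀) {d n k : ℕ} (hd : 2 ≤ d) (hn : 0 < n)
    (hnd : (n : ℝ) ≤ C * (d : ℝ) ^ κ) (hk : k₀ ≤ k)
    {σ : Measure (EuclideanSpace ℝ (Fin d))} (hσ : IsSphereLaw σ) :
    ∫⁻ w, ENNReal.ofReal (opNorm (Matrix.of fun i j => zker k (w i) (w j)) ^ r)
      ∂(Measure.pi fun _ : Fin n => σ)
      ≤ ENNReal.ofReal (2 ^ r + C ^ (r + 4) * (2 ^ k₀ * (k₀.factorial : ℝ))) := by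
  refine (lintegral_gram_rpow_le_entries (k := k) hd hn hσ hr).trans ?_
  refine ENNReal.ofReal_le_ofReal ?_
  gcongr
  have hN : (0 : ℝ) < sphDim d k := by exact_mod_cast sphDim_pos hd k
  have hd1 : (1 : ℝ) ≤ d := by exact_mod_cast (by omega : 1 ≤ d)
  have hd0 : (0 : ℝ) ≤ d := by positivity
  rw [div_le_iff₀ hN]
  calc (n : ℝ) ^ (r + 4) ≤ (C * (d : ℝ) ^ κ) ^ (r + 4) := by gcongr
    _ = C ^ (r + 4) * (d : ℝ) ^ (κ * (r + 4)) := by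
      rw [Real.mul_rpow hC.le (by positivity), ← Real.rpow_mul hd0]
    _ ≤ C ^ (r + 4) * (d : ℝ) ^ (k₀ : ℝ) := by gcongr
    _ ≤ C ^ (r + 4) * (2 ^ k₀ * (k₀.factorial : ℝ) * sphDim d k) := by
      rw [Real.rpow_natCast]
      gcongr
      refine (pow_le_sphDim hd k₀).trans ?_
      gcongr
      exact sphDim_mono hd hk₀ hk
    _ = _ := by ring

theorem exists_QWmat_moment_bound {κ θ : ℝ} {p : ℕ → ℕ} (hp : ∀ d, 0 < p d)
    (hpl : Tendsto (fun d : ℕ => (p d : ℝ) / (d : ℝ) ^ κ) atTop (nhds θ)) {r : ℝ} (hr : 0 ≤ r) :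
    ∃ K : ℝ, 0 < K ∧ ∀ d : ℕ, 1 ≤ d → ∀ k : ℕ, κ ≤ (k : ℝ) →
      ∀ q : Polynomial ℝ, IsGegenbauer d k q →
        (∫⁻ w, ENNReal.ofReal (opNorm (QWmat d (p d) q (sphDim d k) w) ^ r)
            ∂Wmeas d (p d)) ≤ ENNReal.ofReal K := by
  obtain ⟨C, hC, hpC⟩ := exists_bound_mul_rpow hpl
  choose K hK0 hK using exists_bound_fixed_degree hC hr
  set k₀ := max 1 ⌈κ * (r + 4)⌉₊ with hk₀
  have hk₀1 : 1 ≤ k₀ := le_max_left _ _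
  have hκ : κ * (r + 4) ≤ k₀ := (Nat.le_ceil _).trans (by exact_mod_cast le_max_right _ _)
  set A : ℝ := (2 * p 1 : ℝ) ^ r
  set B : ℝ := ∑ k ∈ Finset.range k₀, K k
  set D : ℝ := 2 ^ r + C ^ (r + 4) * (2 ^ k₀ * (k₀.factorial : ℝ))
  have hA : 0 ≤ A := by positivity
  have hB : 0 ≤ B := Finset.sum_nonneg fun k _ => hK0 k
  have hD : 0 < D := by positivity
  refine ⟨A + B + D, by positivity, fun d hd k hk q hq => ?_⟩
  rcases hd.eq_or_lt with rfl | hd2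
  · exact (lintegral_QWmat_dim_one_le hq hr).trans (ENNReal.ofReal_le_ofReal (by linarith))
  have hσ := sphereUniform_isSphereLaw hd hq
  simp only [QWmat_eq hd2 hq, Wmeas]
  rcases lt_or_ge k k₀ with h | h
  · have hd1 : (1 : ℝ) ≤ d := by exact_mod_cast hd
    refine (hK k d (p d) hd2 (hp d) ?_ _ hσ).trans (ENNReal.ofReal_le_ofReal ?_)
    · refine (hpC d hd).trans ?_
      rw [← Real.rpow_natCast]
      gcongr
    · have := Finset.single_le_sum (f := K) (fun k _ => hK0 k) (Finset.mem_range.2 h)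
      linarith
  · exact (lintegral_gram_large_degree_le hC hr hk₀1 hκ hd2 (hp d) (hpC d hd) h hσ).trans
      (ENNReal.ofReal_le_ofReal (by linarith))

/-- In the polynomial scaling `p ≍ d^{κ₁}`, `n ≍ d^{κ₂}`, for every `r ≥ 0`,
`sup_{d ≥ 1} sup_{k ≥ κ₁} E[‖Q_k^W‖_op^r] < ∞` and
`sup_{d ≥ 1} sup_{k ≥ κ₂} E[‖Q_k^X‖_op^r] < ∞`. -/
theorem gegenbauer_gram_all_degrees_moment_bound
    (κ₁ κ₂ θ₁ θ₂ : ℝ) (hκ₁ : 0 < κ₁) (hκ₂ : 0 < κ₂) (hθ₁ : 0 < θ₁) (hθ₂ : 0 < θ₂)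
    (p n : ℕ → ℕ) (hp : ∀ d, 0 < p d) (hn : ∀ d, 0 < n d)
    (hpl : Tendsto (fun d : ℕ => (p d : ℝ) / (d : ℝ) ^ κ₁) atTop (nhds θ₁))
    (hnl : Tendsto (fun d : ℕ => (n d : ℝ) / (d : ℝ) ^ κ₂) atTop (nhds θ₂))
    (r : ℝ) (hr : 0 ≤ r) :
    (∃ K : ℝ, 0 < K ∧ ∀ d : ℕ, 1 ≤ d → ∀ k : ℕ, κ₁ ≤ (k : ℝ) →
      ∀ q : Polynomial ℝ, IsGegenbauer d k q →
        (∫⁻ w, ENNReal.ofReal (opNorm (QWmat d (p d) q (sphDim d k) w) ^ r)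
            ∂Wmeas d (p d)) ≤ ENNReal.ofReal K) ∧
    (∃ K : ℝ, 0 < K ∧ ∀ d : ℕ, 1 ≤ d → ∀ k : ℕ, κ₂ ≤ (k : ℝ) →
      ∀ q : Polynomial ℝ, IsGegenbauer d k q →
        (∫⁻ x, ENNReal.ofReal (opNorm (QXmat d (n d) q (sphDim d k) x) ^ r)
            ∂Xmeas d (n d)) ≤ ENNReal.ofReal K) := by
  refine ⟨exists_QWmat_moment_bound hp hpl hr, ?_⟩
  obtain ⟨K, hK, h⟩ := exists_QWmat_moment_bound hn hnl hr
  exact ⟨K, hK, fun d hd k hk q hq =>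
    (lintegral_Xmeas_le hd hq r _).trans (h d hd k hk q hq)⟩

end
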